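/- arXiv:alg-geom/9702019 — 2 statements merged into one kernel-verified Lean document; each statement's English description precedes it below -/
import Mathlib

section
/- (Fibration theorem / Sard's theorem for polynomials.) Let n ≥ 1 and let f : ℂⁿ → ℂ be a polynomial map. Then there exists a finite set Σ ⊂ ℂ such that the restriction f : ℂⁿ \ f⁻¹(Σ) → ℂ \ Σ is a locally trivial fibration: every c ∈ ℂ \ Σ has an open neighborhood U ⊆ ℂ \ Σ and a homeomorphism h : f⁻¹(U) → U × f⁻¹(c) whose composition with the projection to U equals f. -/
open Filter Topology Polynomial unitInterval

noncomputable section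

/-- A map is a locally trivial fibration: every point `y` of the base has an open
neighborhood `V` and a homeomorphism `f⁻¹(V) ≃ V × f⁻¹(y)` whose composition with the
projection to `V` equals `f`. -/
def LocTrivFibration {X Y : Type*} [TopologicalSpace X] [TopologicalSpace Y] (f : X → Y) : Prop :=
  ∀ y : Y, ∃ V : Set Y, IsOpen V ∧ y ∈ V ∧
    ∃ h : (f ⁻¹' V) ≃ₜ (V × (f ⁻¹' {y})), ∀ x : (f ⁻¹' V), ((h x).1 : Y) = f x

/-- A continuous family of nonzero complex polynomials of constant degree. -/
structure PolyFamily {Z : Type*} [TopologicalSpace Z] (p : Z → ℂ[X]) (d : ℕ) : Prop where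
  continuous_coeff : ∀ k, Continuous fun z => (p z).coeff k
  natDegree_eq : ∀ z, (p z).natDegree = d
  ne_zero : ∀ z, p z ≠ 0

theorem leadingCoeff_mul_prod_le_norm_eval {p : ℂ[X]} {b : ℂ} {r : ℂ → ℝ}
    (hr : ∀ a ∈ p.roots, 0 ≤ r a ∧ r a ≤ ‖b - a‖) :
    ‖p.leadingCoeff‖ * (p.roots.map r).prod ≤ ‖p.eval b‖ := by
  rw [(IsAlgClosed.splits p).eval_eq_prod_roots b, norm_mul]
  refine mul_le_mul_of_nonneg_left ?_ (norm_nonneg _)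
  have : ‖(p.roots.map (fun a => b - a)).prod‖ = (p.roots.map (fun a => ‖b - a‖)).prod := by
    simpa [Multiset.map_map, Function.comp_def] using
      map_multiset_prod (normHom : ℂ →*₀ ℝ) (p.roots.map (fun a => b - a))
  rw [this]
  exact Multiset.prod_map_le_prod_map₀ _ _ (fun a ha => (hr a ha).1) (fun a ha => (hr a ha).2)

theorem norm_eval_le_sum {q : ℂ[X]} {d : ℕ} (hq : q.natDegree ≤ d) (b : ℂ) :
    ‖q.eval b‖ ≤ ∑ k ∈ Finset.range (d + 1), ‖q.coeff k‖ * ‖b‖ ^ k := by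
  rw [eval_eq_sum_range' (Nat.lt_succ_of_le hq)]
  exact (norm_sum_le _ _).trans (Finset.sum_le_sum fun k _ => by simp)

namespace PolyFamily

variable {Z : Type*} [TopologicalSpace Z] {p : Z → ℂ[X]} {d : ℕ}

theorem continuous_eval (hp : PolyFamily p d) {g : Z → ℂ} (hg : Continuous g) :
    Continuous fun z => (p z).eval (g z) := by
  have : (fun z => (p z).eval (g z)) =
      fun z => ∑ k ∈ Finset.range (d + 1), (p z).coeff k * g z ^ k := by
    funext z
    rw [eval_eq_sum_range, hp.natDegree_eq]
  rw [this]
  exact continuous_finsetSum _ fun k _ => (hp.continuous_coeff k).mul (hg.pow k)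

theorem comp (hp : PolyFamily p d) {W : Type*} [TopologicalSpace W] {g : W → Z}
    (hg : Continuous g) : PolyFamily (fun w => p (g w)) d :=
  ⟨fun k => (hp.continuous_coeff k).comp hg, fun _ => hp.natDegree_eq _, fun _ => hp.ne_zero _⟩

theorem continuous_leadingCoeff (hp : PolyFamily p d) :
    Continuous fun z => (p z).leadingCoeff := by
  simp only [leadingCoeff, hp.natDegree_eq]
  exact hp.continuous_coeff d

theorem leadingCoeff_norm_pos (hp : PolyFamily p d) (z : Z) : 0 < ‖(p z).leadingCoeff‖ := by
  simpa using hp.ne_zero z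

theorem card_roots (hp : PolyFamily p d) (z : Z) : (p z).roots.card = d := by
  rw [← (IsAlgClosed.splits (p z)).natDegree_eq_card_roots, hp.natDegree_eq]

/-- Near `z₀`, every root of `p z₀` is close to a root of `p z`. -/
theorem eventually_exists_root_near (hp : PolyFamily p d) (z₀ : Z) {κ : ℝ} (hκ : 0 < κ) :
    ∀ᶠ z in 𝓝 z₀, ∀ a ∈ (p z₀).roots, ∃ b ∈ (p z).roots, ‖b - a‖ < κ := by
  have key : ∀ a ∈ (p z₀).roots.toFinset, ∀ᶠ z in 𝓝 z₀,
      ‖(p z).eval a‖ < ‖(p z).leadingCoeff‖ * κ ^ d := by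
    intro a ha
    refine ContinuousAt.eventually_lt (hp.continuous_eval continuous_const).norm.continuousAt
      (hp.continuous_leadingCoeff.norm.mul continuous_const).continuousAt ?_
    have : (p z₀).eval a = 0 := (mem_roots'.1 (Multiset.mem_toFinset.1 ha)).2
    rw [this, norm_zero]
    exact mul_pos (hp.leadingCoeff_norm_pos _) (pow_pos hκ _)
  filter_upwards [(eventually_all_finset _).2 key] with z hz a ha
  by_contra! h
  have := leadingCoeff_mul_prod_le_norm_eval (p := p z) (b := a) (r := fun _ => κ)
    (fun b hb => ⟨hκ.le, by rw [norm_sub_rev]; exact h b hb⟩)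
  rw [Multiset.map_const', Multiset.prod_replicate, hp.card_roots] at this
  exact absurd (hz a (Multiset.mem_toFinset.2 ha)) (not_lt.2 this)

/-- Near `z₀`, every root of `p z` is close to a root of `p z₀`. -/
theorem eventually_root_near (hp : PolyFamily p d) (z₀ : Z) {κ : ℝ} (hκ : 0 < κ) :
    ∀ᶠ z in 𝓝 z₀, ∀ b ∈ (p z).roots, ∃ a ∈ (p z₀).roots, ‖b - a‖ < κ := by
  obtain ⟨A, hA⟩ : ∃ A : ℝ, ∀ a ∈ (p z₀).roots, ‖a‖ ≤ A :=
    ⟨∑ a ∈ (p z₀).roots.toFinset, ‖a‖, fun a ha =>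
      Finset.single_le_sum (f := fun a => ‖a‖) (fun _ _ => norm_nonneg _)
        (Multiset.mem_toFinset.2 ha)⟩
  set B : ℝ := (1 + |A|) / κ + 1 with hB
  have hB0 : 0 < B := by positivity
  have hlim : Tendsto (fun z => ∑ k ∈ Finset.range (d + 1), ‖(p z₀ - p z).coeff k‖) (𝓝 z₀)
      (𝓝 0) := by
    have : Continuous fun z => ∑ k ∈ Finset.range (d + 1), ‖(p z₀ - p z).coeff k‖ := by
      simp only [coeff_sub]
      exact continuous_finsetSum _ fun k _ => (continuous_const.sub (hp.continuous_coeff k)).norm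
    simpa using this.tendsto z₀
  have hpos : 0 < ‖(p z₀).leadingCoeff‖ * (B⁻¹) ^ d :=
    mul_pos (hp.leadingCoeff_norm_pos _) (by positivity)
  filter_upwards [hlim.eventually_lt_const hpos] with z hz b hb
  by_contra! h
  have h1 := leadingCoeff_mul_prod_le_norm_eval (p := p z₀) (b := b)
    (r := fun _ => B⁻¹ * (1 + ‖b‖)) (fun a ha => ⟨by positivity, by
      have h2 := h a ha
      have h3 := hA a ha
      have h4 : ‖b‖ ≤ ‖b - a‖ + ‖a‖ := by simpa using norm_add_le (b - a) a
      have h5 : (1 + |A|) ≤ (1 + |A|) / κ * ‖b - a‖ := by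
        rw [div_mul_eq_mul_div, le_div_iff₀ hκ]
        exact mul_le_mul_of_nonneg_left h2 (by positivity)
      rw [inv_mul_le_iff₀ hB0, hB]
      nlinarith [le_abs_self A]⟩)
  rw [Multiset.map_const', Multiset.prod_replicate, hp.card_roots] at h1
  have h2 : (p z₀).eval b = (p z₀ - p z).eval b := by
    rw [eval_sub, (mem_roots'.1 hb).2, sub_zero]
  have hdeg : (p z₀ - p z).natDegree ≤ d :=
    (natDegree_sub_le _ _).trans (by simp [hp.natDegree_eq])
  have h3 := norm_eval_le_sum hdeg b
  have h4 : ∑ k ∈ Finset.range (d + 1), ‖(p z₀ - p z).coeff k‖ * ‖b‖ ^ k ≤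
      (∑ k ∈ Finset.range (d + 1), ‖(p z₀ - p z).coeff k‖) * (1 + ‖b‖) ^ d := by
    rw [Finset.sum_mul]
    refine Finset.sum_le_sum fun k hk => mul_le_mul_of_nonneg_left ?_ (norm_nonneg _)
    calc ‖b‖ ^ k ≤ (1 + ‖b‖) ^ k := pow_le_pow_left₀ (norm_nonneg _) (by linarith) _
      _ ≤ (1 + ‖b‖) ^ d := pow_le_pow_right₀ (by linarith [norm_nonneg b])
        (Nat.lt_succ_iff.1 (Finset.mem_range.1 hk))
  rw [h2, mul_pow, ← mul_assoc] at h1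
  have h5 : (0:ℝ) < (1 + ‖b‖) ^ d := by positivity
  exact absurd hz (not_lt.2 (le_of_mul_le_mul_right (h1.trans (h3.trans h4)) h5))

/-- Uniform continuity of the root set along a compact parameter space. -/
theorem eventually_forall_roots_near {Y K : Type*} [TopologicalSpace Y] [TopologicalSpace K]
    [CompactSpace K] {p : Y × K → ℂ[X]} (hp : PolyFamily p d) (y₀ : Y) {κ : ℝ} (hκ : 0 < κ) :
    ∀ᶠ y in 𝓝 y₀, ∀ s : K, (∀ b ∈ (p (y, s)).roots, ∃ a ∈ (p (y₀, s)).roots, ‖b - a‖ < κ) ∧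
      ∀ a ∈ (p (y₀, s)).roots, ∃ b ∈ (p (y, s)).roots, ‖b - a‖ < κ := by
  have := isCompact_univ.eventually_forall_of_forall_eventually (x₀ := y₀) (K := (Set.univ : Set K))
    (P := fun y s => (∀ b ∈ (p (y, s)).roots, ∃ a ∈ (p (y₀, s)).roots, ‖b - a‖ < κ) ∧
      ∀ a ∈ (p (y₀, s)).roots, ∃ b ∈ (p (y, s)).roots, ‖b - a‖ < κ) (fun s _ => by
    have h1 := hp.eventually_exists_root_near (y₀, s) (half_pos hκ)
    have h2 := hp.eventually_root_near (y₀, s) (half_pos hκ)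
    have hc : Tendsto (fun z : Y × K => (y₀, z.2)) (𝓝 (y₀, s)) (𝓝 (y₀, s)) :=
      Continuous.tendsto' (by fun_prop) _ _ rfl
    filter_upwards [h1, h2, hc.eventually h1, hc.eventually h2] with z k1 k2 k3 k4
    have tri : ∀ x y w : ℂ, ‖x - y‖ < κ / 2 → ‖w - y‖ < κ / 2 → ‖x - w‖ < κ := by
      intro x y w h h'
      have := norm_sub_le (x - y) (w - y)
      rw [sub_sub_sub_cancel_right] at this
      linarith
    refine ⟨fun b hb => ?_, fun a ha => ?_⟩
    · obtain ⟨a, ha, hab⟩ := k2 b hb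
      obtain ⟨a', ha', hab'⟩ := k3 a ha
      exact ⟨a', ha', tri _ _ _ hab hab'⟩
    · obtain ⟨a', ha', hab'⟩ := k4 a ha
      obtain ⟨b, hb, hbb⟩ := k1 a' ha'
      exact ⟨b, hb, tri _ _ _ hbb hab'⟩)
  filter_upwards [this] with y hy s using hy s (Set.mem_univ s)

end PolyFamily

/-- Distinct roots of each `q s` are at distance at least `g`. -/
def RootGap {Z : Type*} (q : Z → ℂ[X]) (g : ℝ) : Prop :=
  ∀ s, ∀ a ∈ (q s).roots, ∀ b ∈ (q s).roots, a ≠ b → g ≤ ‖a - b‖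

/-- A continuous choice of a root of each member of a family of polynomials. -/
structure RootArc {Z : Type*} [TopologicalSpace Z] (q : Z → ℂ[X]) (α : Z → ℂ) : Prop where
  continuous : Continuous α
  mem_roots : ∀ s, α s ∈ (q s).roots

theorem eq_of_norm_sub_lt_gap {Z : Type*} {q : Z → ℂ[X]} {g : ℝ} (h : RootGap q g) {s : Z}
    {a b : ℂ} (ha : a ∈ (q s).roots) (hb : b ∈ (q s).roots) (hab : ‖a - b‖ < g) : a = b := by
  by_contra hne
  exact absurd hab (not_lt.2 (h s a ha b hb hne))

theorem exists_local_rootArc {Z : Type*} [TopologicalSpace Z] {q : Z → ℂ[X]} {d : ℕ}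
    (hq : PolyFamily q d) {g : ℝ} (hg : 0 < g) (hgap : RootGap q g) {s₁ : Z} {a : ℂ}
    (ha : a ∈ (q s₁).roots) (hnear : ∀ s, ∃ b ∈ (q s).roots, ‖b - a‖ < g / 4) :
    ∃ β, RootArc q β ∧ β s₁ = a := by
  choose β hβ hβa using hnear
  refine ⟨β, ⟨continuous_iff_continuousAt.2 fun s => Metric.continuousAt_iff'.2 fun κ hκ => ?_,
    hβ⟩, ?_⟩
  · filter_upwards [hq.eventually_exists_root_near s (lt_min hκ (div_pos hg four_pos))] with v hv
    obtain ⟨b, hb, hbs⟩ := hv _ (hβ s)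
    have : b = β v := by
      refine eq_of_norm_sub_lt_gap hgap hb (hβ v) ?_
      have h1 := hβa s
      have h2 := hβa v
      have h3 := lt_of_lt_of_le hbs (min_le_right _ _)
      have : b - β v = (b - β s) + (β s - a) - (β v - a) := by ring
      rw [this]
      have h4 := norm_sub_le ((b - β s) + (β s - a)) (β v - a)
      have h5 := norm_add_le (b - β s) (β s - a)
      linarith
    rw [dist_eq_norm, ← this]
    exact lt_of_lt_of_le hbs (min_le_left _ _)
  · refine eq_of_norm_sub_lt_gap hgap (hβ s₁) ha ((hβa s₁).trans (by linarith))

theorem exists_rootArc_of_uniform {q : ℝ → ℂ[X]} {d : ℕ} (hq : PolyFamily q d) {g : ℝ}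
    (hg : 0 < g) (hgap : RootGap q g) {δ : ℝ} (hδ : 0 < δ)
    (hnear : ∀ u v, |u - v| ≤ δ → ∀ a ∈ (q v).roots, ∃ b ∈ (q u).roots, ‖b - a‖ < g / 4)
    {s₀ : ℝ} {a : ℂ} (ha : a ∈ (q s₀).roots) (k : ℕ) :
    ∃ α : ℝ → ℂ, Continuous α ∧ α s₀ = a ∧ ∀ s, |s - s₀| ≤ k * δ → α s ∈ (q s).roots := by
  induction k with
  | zero =>
    refine ⟨fun _ => a, continuous_const, rfl, fun s hs => ?_⟩
    have : s = s₀ := by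
      have := abs_nonpos_iff.1 (by simpa using hs : |s - s₀| ≤ 0)
      linarith
    rwa [this]
  | succ k ih =>
    obtain ⟨α, hα, hα0, hαr⟩ := ih
    have hkδ : 0 ≤ k * δ := by positivity
    have loc : ∀ u : ℝ, α u ∈ (q u).roots → ∃ β : ℝ → ℂ, Continuous β ∧ β u = α u ∧
        ∀ s, |s - u| ≤ δ → β s ∈ (q s).roots := by
      intro u hu
      let c : ℝ → ℝ := fun s => max (u - δ) (min s (u + δ))
      have hc : Continuous c := by fun_prop
      have hcs : ∀ s, |s - u| ≤ δ → c s = s := by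
        intro s hs
        have := abs_le.1 hs
        simp only [c]
        rw [min_eq_left (by linarith), max_eq_right (by linarith)]
      have hcu : c u = u := hcs u (by simpa using hδ.le)
      obtain ⟨β, hβ, hβu⟩ := exists_local_rootArc (hq.comp hc) hg
        (fun s => hgap (c s)) (s₁ := u) (a := α u) (by rwa [hcu]) (fun s => hnear _ u (by
          simp only [c]
          rw [abs_le]
          constructor
          · linarith [le_max_left (u - δ) (min s (u + δ))]
          · have : max (u - δ) (min s (u + δ)) ≤ u + δ :=
              max_le (by linarith) (min_le_right _ _)
            linarith) _ hu)
      refine ⟨β, hβ.continuous, hβu, fun s hs => ?_⟩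
      have := hβ.mem_roots s
      rwa [hcs s hs] at this
    have hu : α (s₀ + k * δ) ∈ (q (s₀ + k * δ)).roots :=
      hαr _ (by rw [add_sub_cancel_left, abs_of_nonneg hkδ])
    have hw : α (s₀ - k * δ) ∈ (q (s₀ - k * δ)).roots :=
      hαr _ (by rw [sub_sub_cancel_left, abs_neg, abs_of_nonneg hkδ])
    obtain ⟨β, hβ, hβu, hβr⟩ := loc _ hu
    obtain ⟨γ, hγ, hγw, hγr⟩ := loc _ hw
    set u := s₀ + k * δ with hu_def
    set w := s₀ - k * δ with hw_def
    refine ⟨fun s => α (max w (min s u)) + (β (max s u) - α u) + (γ (min s w) - α w),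
      by fun_prop, ?_, fun s hs => ?_⟩
    · simp only
      rw [min_eq_left (by linarith : s₀ ≤ u), max_eq_right (by linarith : w ≤ s₀),
        max_eq_right (by linarith : s₀ ≤ u), min_eq_right (by linarith : w ≤ s₀), hβu, hγw, hα0]
      ring
    · push_cast at hs
      obtain ⟨hs1, hs2⟩ := abs_le.1 hs
      simp only
      rcases le_total s u with h1 | h1
      · rcases le_total w s with h2 | h2
        · rw [min_eq_left h1, max_eq_right h2, max_eq_right h1, min_eq_right h2, hβu, hγw]
          simpa using hαr s (abs_le.2 ⟨by linarith, by linarith⟩)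
        · rw [min_eq_left h1, max_eq_left h2, max_eq_right h1, min_eq_left h2, hβu]
          simpa using hγr s (abs_le.2 ⟨by linarith, by linarith⟩)
      · rw [min_eq_right h1, max_eq_right (by linarith : w ≤ u), max_eq_left h1,
          min_eq_right (by linarith : w ≤ s), hγw]
        simpa using hβr s (abs_le.2 ⟨by linarith, by linarith⟩)

/-- Through every root of a member of a family with a root gap over `[0, 1]` passes an arc. -/
theorem exists_rootArc {q : I → ℂ[X]} {d : ℕ} (hq : PolyFamily q d) {g : ℝ}
    (hg : 0 < g) (hgap : RootGap q g) {s₀ : I} {a : ℂ} (ha : a ∈ (q s₀).roots) :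
    ∃ α, RootArc q α ∧ α s₀ = a := by
  let c : ℝ → I := Set.projIcc 0 1 zero_le_one
  have hc : Continuous c := continuous_projIcc
  have hcI : ∀ s : I, c s = s := fun s => Set.projIcc_val _ s
  have hfam : PolyFamily (fun z : ℝ × I => q (c (z.2 + z.1))) d :=
    hq.comp (g := fun z : ℝ × I => c (z.2 + z.1)) (by fun_prop)
  have := hfam.eventually_forall_roots_near 0 (div_pos hg four_pos)
  obtain ⟨δ, hδ, hball⟩ := Metric.eventually_nhds_iff.1 this
  have hnear : ∀ u v : ℝ, |u - v| ≤ δ / 2 → ∀ a ∈ (q (c v)).roots, ∃ b ∈ (q (c u)).roots,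
      ‖b - a‖ < g / 4 := by
    intro u v huv a ha
    have h1 : dist ((c u : ℝ) - c v) 0 < δ := by
      rw [dist_zero_right, Real.norm_eq_abs]
      have : |(c u : ℝ) - c v| ≤ |u - v| := Set.abs_projIcc_sub_projIcc zero_le_one
      linarith
    have h2 := (hball h1 (c v)).2 a (by simpa [hcI] using ha)
    simpa [hcI] using h2
  obtain ⟨k, hk⟩ := exists_nat_ge (1 / (δ / 2))
  obtain ⟨α, hα, hα0, hαr⟩ := exists_rootArc_of_uniform (hq.comp hc) hg (fun s => hgap (c s))
    (half_pos hδ) hnear (s₀ := s₀) (a := a) (by simpa [hcI] using ha) k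
  refine ⟨fun s => α s, ⟨by fun_prop, fun s => ?_⟩, hα0⟩
  have := hαr s (by
    have h1 : |(s : ℝ) - s₀| ≤ 1 := by
      rw [abs_le]
      constructor <;> linarith [s.2.1, s.2.2, s₀.2.1, s₀.2.2]
    have h2 : 1 ≤ k * (δ / 2) := by rwa [div_le_iff₀ (half_pos hδ)] at hk
    linarith)
  simpa [hcI] using this

/-- Every difference of roots of `q s` is relatively close to a difference of roots of `q 0`. -/
def DiffControl (q : I → ℂ[X]) (δ : ℝ) : Prop :=
  ∀ s, ∀ a ∈ (q s).roots, ∀ b ∈ (q s).roots, ∃ a' ∈ (q 0).roots, ∃ b' ∈ (q 0).roots,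
    ‖(a - b) - (a' - b')‖ ≤ δ * ‖a' - b'‖

theorem DiffControl.exists_gap {q : I → ℂ[X]} {δ : ℝ} (h : DiffControl q δ) (hδ : δ ≤ 1 / 2) :
    ∃ g, 0 < g ∧ RootGap q g := by
  have : ∀ᶠ g : ℝ in 𝓝[>] 0, ∀ a ∈ (q 0).roots.toFinset, ∀ b ∈ (q 0).roots.toFinset,
      a ≠ b → g ≤ ‖a - b‖ / 2 := by
    refine (eventually_all_finset _).2 fun a _ => (eventually_all_finset _).2 fun b _ => ?_
    by_cases hab : a = b
    · exact Eventually.of_forall fun _ h => absurd hab h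
    · have : 0 < ‖a - b‖ / 2 := half_pos (norm_pos_iff.2 (sub_ne_zero.2 hab))
      filter_upwards [nhdsWithin_le_nhds (Iic_mem_nhds this)] with g hg _ using hg
  obtain ⟨g, hg, hg0⟩ := (this.and self_mem_nhdsWithin).exists
  refine ⟨g, hg0, fun s a ha b hb hab => ?_⟩
  obtain ⟨a', ha', b', hb', h1⟩ := h s a ha b hb
  have h2 : ‖a' - b'‖ ≤ ‖a - b‖ + ‖(a - b) - (a' - b')‖ := by
    have := norm_sub_le (a - b) ((a - b) - (a' - b'))
    rwa [sub_sub_cancel] at this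
  have h3 : a' ≠ b' := by
    rintro rfl
    simp only [sub_self, sub_zero, norm_zero, mul_zero] at h1
    exact hab (sub_eq_zero.1 (norm_le_zero_iff.1 h1))
  have h4 := hg a' (Multiset.mem_toFinset.2 ha') b' (Multiset.mem_toFinset.2 hb') h3
  nlinarith [norm_nonneg (a' - b')]

theorem exists_eq_of_le_of_le {ρ : I → ℝ} (hρ : Continuous ρ) {v : ℝ} (h0 : ρ 0 ≤ v)
    (h1 : v ≤ ρ 1) : ∃ s, ρ s = v := by
  obtain ⟨s, -, hs⟩ := isPreconnected_univ.intermediate_value (Set.mem_univ (0 : I))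
    (Set.mem_univ (1 : I)) hρ.continuousOn ⟨h0, h1⟩
  exact ⟨s, hs⟩

/-- Differences of root arcs move relatively little. -/
theorem RootArc.norm_sub_sub_le {q : I → ℂ[X]} {d : ℕ} (hq : PolyFamily q d) {δ L : ℝ}
    (h : DiffControl q δ) (hL1 : L ≤ 1) (hδ0 : 0 ≤ δ)
    (hδ : δ ≤ 1 / 2) (hδL : 8 * δ * (d * d + 1) < L) {α β : I → ℂ} (hα : RootArc q α)
    (hβ : RootArc q β) :
    ‖(α 1 - β 1) - (α 0 - β 0)‖ ≤ L * ‖α 0 - β 0‖ := by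
  have hL : 0 < L := lt_of_le_of_lt (by positivity) hδL
  obtain ⟨g, hg, hgap⟩ := h.exists_gap hδ
  have hcα := hα.continuous
  have hcβ := hβ.continuous
  by_cases h0 : α 0 - β 0 = 0
  · have h1 : α 1 = β 1 := by
      refine eq_of_norm_sub_lt_gap hgap (hα.mem_roots 1) (hβ.mem_roots 1) ?_
      by_contra! hge
      obtain ⟨s, hs⟩ := exists_eq_of_le_of_le (ρ := fun s => ‖α s - β s‖) (by fun_prop)
        (v := g / 2) (by simp only [h0, norm_zero]; linarith) (by linarith)
      have := eq_of_norm_sub_lt_gap hgap (hα.mem_roots s) (hβ.mem_roots s) (by linarith)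
      rw [this] at hs
      simp only [sub_self, norm_zero] at hs
      linarith
    rw [h0, h1]
    simp
  set w : I → ℂ := fun s => α s - β s with hw
  have hwc : Continuous w := by fun_prop
  have hw0 : 0 < ‖w 0‖ := norm_pos_iff.2 h0
  by_contra! hcon
  have hN : (0 : ℝ) < d * d + 1 := by positivity
  have hval : ∀ k : Fin (d * d + 1 + 1), ∃ s, ‖w s - w 0‖ = k / (d * d + 1) * (L * ‖w 0‖) := by
    intro k
    have hk : (k : ℝ) ≤ d * d + 1 := by exact_mod_cast Nat.lt_succ_iff.1 k.2
    refine exists_eq_of_le_of_le (ρ := fun s => ‖w s - w 0‖) (by fun_prop) ?_ ?_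
    · simp only [sub_self, norm_zero]
      positivity
    · refine le_trans ?_ hcon.le
      have : (k : ℝ) / (d * d + 1) ≤ 1 := (div_le_one hN).2 hk
      exact mul_le_of_le_one_left (by positivity) this
  choose s hs using hval
  choose a' ha' b' hb' hab using fun k => h (s k) _ (hα.mem_roots (s k)) _ (hβ.mem_roots (s k))
  have hcard : ((q 0).roots.toFinset ×ˢ (q 0).roots.toFinset).card <
      (Finset.univ : Finset (Fin (d * d + 1 + 1))).card := by
    rw [Finset.card_product, Finset.card_fin]
    have := (q 0).roots.toFinset_card_le
    rw [hq.card_roots] at this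
    nlinarith [Nat.mul_le_mul this this]
  obtain ⟨k, -, k', -, hkk, heq⟩ := Finset.exists_ne_map_eq_of_card_lt_of_maps_to hcard
    (f := fun k => (a' k, b' k)) (fun k _ => by simpa using ⟨⟨(hq.ne_zero 0),
      (mem_roots'.1 (ha' k)).2⟩, (hq.ne_zero 0), (mem_roots'.1 (hb' k)).2⟩)
  simp only [Prod.mk.injEq] at heq
  set v := a' k - b' k with hv
  have e1 : ‖w (s k) - v‖ ≤ δ * ‖v‖ := hab k
  have e2 : ‖w (s k') - v‖ ≤ δ * ‖v‖ := by
    have := hab k'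
    rwa [← heq.1, ← heq.2] at this
  have hkle : ∀ k : Fin (d * d + 1 + 1), (k : ℝ) / (d * d + 1) ≤ 1 := fun k =>
    (div_le_one hN).2 (by exact_mod_cast Nat.lt_succ_iff.1 k.2)
  have hLw : 0 ≤ L * ‖w 0‖ := by positivity
  have hvn : ‖v‖ ≤ 4 * ‖w 0‖ := by
    have f1 : ‖w (s k) - w 0‖ ≤ ‖w 0‖ := by
      rw [hs k]
      calc (k : ℝ) / (d * d + 1) * (L * ‖w 0‖) ≤ 1 * (L * ‖w 0‖) :=
            mul_le_mul_of_nonneg_right (hkle k) hLw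
        _ ≤ ‖w 0‖ := by nlinarith
    have f2 : ‖v‖ ≤ ‖w (s k) - v‖ + ‖w (s k) - w 0‖ + ‖w 0‖ := by
      have : v = (w (s k) - w 0) + w 0 - (w (s k) - v) := by ring
      have g1 := norm_sub_le ((w (s k) - w 0) + w 0) (w (s k) - v)
      rw [← this] at g1
      linarith [norm_add_le (w (s k) - w 0) (w 0)]
    nlinarith [norm_nonneg v]
  have hdist : |(k : ℝ) - k'| / (d * d + 1) * (L * ‖w 0‖) ≤ 2 * (δ * ‖v‖) := by
    have g1 : |‖w (s k) - w 0‖ - ‖w (s k') - w 0‖| ≤ ‖w (s k) - w (s k')‖ := by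
      have := abs_norm_sub_norm_le (w (s k) - w 0) (w (s k') - w 0)
      rwa [sub_sub_sub_cancel_right] at this
    have g2 : ‖w (s k) - w (s k')‖ ≤ ‖w (s k) - v‖ + ‖w (s k') - v‖ := by
      have := norm_sub_le (w (s k) - v) (w (s k') - v)
      rwa [sub_sub_sub_cancel_right] at this
    rw [hs k, hs k', ← sub_mul, ← sub_div, abs_mul, abs_div, abs_of_nonneg hLw,
      abs_of_pos hN] at g1
    linarith
  have hone : (1 : ℝ) ≤ |(k : ℝ) - k'| := by
    have : (1 : ℤ) ≤ |(k : ℤ) - k'| := Int.one_le_abs (by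
      intro h
      exact hkk (Fin.ext (by omega)))
    exact_mod_cast this
  have hfin : L * ‖w 0‖ ≤ 8 * δ * (d * d + 1) * ‖w 0‖ := by
    have g1 : 1 / (d * d + 1) * (L * ‖w 0‖) ≤ |(k : ℝ) - k'| / (d * d + 1) * (L * ‖w 0‖) := by
      gcongr
    have g2 : δ * ‖v‖ ≤ δ * (4 * ‖w 0‖) := mul_le_mul_of_nonneg_left hvn hδ0
    have g3 : 1 / (d * d + 1) * (L * ‖w 0‖) ≤ 8 * δ * ‖w 0‖ := by linarith
    rw [div_mul_eq_mul_div, one_mul, div_le_iff₀ hN] at g3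
    linarith
  nlinarith

/-- The largest-slope extension of `v`, defined on the finite set `A`, to all of `ℂ`. -/
def mcShane (L : ℝ) (A : Finset ℂ) (hA : A.Nonempty) (v : ℂ → ℝ) (z : ℂ) : ℝ :=
  A.inf' hA fun a => v a + L * ‖z - a‖

theorem mcShane_le_add {L ε : ℝ} {A B : Finset ℂ} (hA : A.Nonempty) (hB : B.Nonempty)
    {v u : ℂ → ℝ} {z w : ℂ}
    (h : ∀ b ∈ B, ∃ a ∈ A, v a + L * ‖z - a‖ ≤ u b + L * ‖w - b‖ + ε) :
    mcShane L A hA v z ≤ mcShane L B hB u w + ε := by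
  obtain ⟨b, hb, hbe⟩ := Finset.exists_mem_eq_inf' hB fun b => u b + L * ‖w - b‖
  obtain ⟨a, ha, hab⟩ := h b hb
  unfold mcShane
  rw [hbe]
  exact (Finset.inf'_le _ ha).trans hab

theorem mcShane_le_add_norm {L : ℝ} (hL : 0 ≤ L) {A : Finset ℂ} (hA : A.Nonempty)
    (v : ℂ → ℝ) (z w : ℂ) : mcShane L A hA v z ≤ mcShane L A hA v w + L * ‖z - w‖ := by
  refine mcShane_le_add hA hA fun a ha => ⟨a, ha, ?_⟩
  have : ‖z - a‖ ≤ ‖z - w‖ + ‖w - a‖ := norm_sub_le_norm_sub_add_norm_sub z w a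
  nlinarith

theorem abs_mcShane_sub_le {L : ℝ} (hL : 0 ≤ L) {A : Finset ℂ} (hA : A.Nonempty)
    (v : ℂ → ℝ) (z w : ℂ) : |mcShane L A hA v z - mcShane L A hA v w| ≤ L * ‖z - w‖ := by
  rw [abs_le]
  have h1 := mcShane_le_add_norm hL hA v z w
  have h2 := mcShane_le_add_norm hL hA v w z
  rw [norm_sub_rev] at h2
  constructor <;> linarith

theorem mcShane_eq {L : ℝ} {A : Finset ℂ} (hA : A.Nonempty) {v : ℂ → ℝ} {b : ℂ} (hb : b ∈ A)
    (hv : ∀ a ∈ A, |v b - v a| ≤ L * ‖b - a‖) : mcShane L A hA v b = v b := by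
  refine le_antisymm ((Finset.inf'_le _ hb).trans (by simp)) (Finset.le_inf' _ _ fun a ha => ?_)
  linarith [(abs_le.1 (hv a ha)).2]

theorem continuous_mcShane {Y : Type*} [TopologicalSpace Y] {L : ℝ} (hL : 0 ≤ L)
    {A : Y → Finset ℂ} (hA : ∀ y, (A y).Nonempty) {v : Y → ℂ → ℝ}
    (h : ∀ y₀, ∀ κ > 0, ∀ᶠ y in 𝓝 y₀,
      (∀ a ∈ A y₀, ∃ b ∈ A y, ‖b - a‖ < κ ∧ |v y b - v y₀ a| < κ) ∧
      ∀ b ∈ A y, ∃ a ∈ A y₀, ‖b - a‖ < κ ∧ |v y b - v y₀ a| < κ) :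
    Continuous fun x : Y × ℂ => mcShane L (A x.1) (hA x.1) (v x.1) x.2 := by
  refine continuous_iff_continuousAt.2 fun ⟨y₀, z₀⟩ => Metric.continuousAt_iff'.2 fun ε hε => ?_
  set κ := ε / (2 * (1 + 2 * L)) with hκ
  have hκ0 : 0 < κ := by positivity
  have hκε : κ * (1 + 2 * L) < ε := by
    rw [hκ, div_mul_eq_mul_div, div_lt_iff₀ (by positivity)]
    nlinarith
  have hz : ∀ᶠ z in 𝓝 z₀, ‖z - z₀‖ < κ := by
    filter_upwards [Metric.ball_mem_nhds z₀ hκ0] with z hz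
    rwa [Metric.mem_ball, dist_eq_norm] at hz
  rw [nhds_prod_eq]
  filter_upwards [(h y₀ κ hκ0).prod_mk hz] with ⟨y, z⟩ ⟨⟨h1, h2⟩, h3⟩
  simp only at h1 h2 h3 ⊢
  rw [Real.dist_eq]
  refine lt_of_le_of_lt (abs_sub_le_iff.2 ⟨?_, ?_⟩) hκε
  · rw [sub_le_iff_le_add']
    refine mcShane_le_add _ _ fun a ha => ?_
    obtain ⟨b, hb, hba, hv⟩ := h1 a ha
    refine ⟨b, hb, ?_⟩
    have e1 : ‖z - b‖ ≤ ‖z - z₀‖ + ‖z₀ - a‖ + ‖b - a‖ := by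
      have : z - b = (z - z₀) + (z₀ - a) - (b - a) := by ring
      rw [this]
      exact (norm_sub_le _ _).trans (by gcongr; exact norm_add_le _ _)
    have := (abs_lt.1 hv).2
    nlinarith
  · rw [sub_le_iff_le_add']
    refine mcShane_le_add _ _ fun b hb => ?_
    obtain ⟨a, ha, hba, hv⟩ := h2 b hb
    refine ⟨a, ha, ?_⟩
    have e1 : ‖z₀ - a‖ ≤ ‖z - z₀‖ + ‖z - b‖ + ‖b - a‖ := by
      have : z₀ - a = (z - b) - (z - z₀) + (b - a) := by ring
      rw [this]
      refine (norm_add_le _ _).trans ?_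
      have := norm_sub_le (z - b) (z - z₀)
      linarith
    have := (abs_lt.1 hv).1
    nlinarith

section Displacement

variable {Y : Type*} [TopologicalSpace Y] {p : Y × I → ℂ[X]} {d : ℕ}

theorem RootArc.norm_sub_lt_of_near {q q' : I → ℂ[X]} {g κ : ℝ} (hgap : RootGap q g)
    (hκg : 2 * κ ≤ g) (hnear : ∀ s, ∀ b ∈ (q' s).roots, ∃ a ∈ (q s).roots, ‖b - a‖ < κ)
    {α β : I → ℂ} (hα : RootArc q α) (hβ : RootArc q' β) (h0 : ‖β 0 - α 0‖ < κ) :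
    ‖β 1 - α 1‖ < κ := by
  have hcα := hα.continuous
  have hcβ := hβ.continuous
  by_contra! hge
  obtain ⟨s, hs⟩ := exists_eq_of_le_of_le (ρ := fun s => ‖β s - α s‖) (by fun_prop) h0.le hge
  obtain ⟨a, ha, hab⟩ := hnear s _ (hβ.mem_roots s)
  have : a = α s := by
    refine eq_of_norm_sub_lt_gap hgap ha (hα.mem_roots s) ?_
    have h1 : a - α s = (β s - α s) - (β s - a) := by ring
    rw [h1]
    have h2 := norm_sub_le (β s - α s) (β s - a)
    linarith
  rw [this] at hab
  exact hab.ne hs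

/-- Interpolation of the motion of the roots of a family of polynomials by a displacement field
with small Lipschitz constant. -/
theorem exists_displacement (hp : PolyFamily p d) (hd : d ≠ 0) {δ L : ℝ}
    (h : ∀ y, DiffControl (fun s => p (y, s)) δ) (hL1 : L ≤ 1) (hδ0 : 0 ≤ δ)
    (hδ : δ ≤ 1 / 2) (hδL : 8 * δ * (d * d + 1) < L) :
    ∃ η : Y × ℂ → ℂ, Continuous η ∧ (∀ y z w, ‖η (y, z) - η (y, w)‖ ≤ 2 * L * ‖z - w‖) ∧
      ∀ y α, RootArc (fun s => p (y, s)) α → η (y, α 0) = α 1 - α 0 := by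
  have hL : 0 < L := lt_of_le_of_lt (by positivity) hδL
  have hfam : ∀ y, PolyFamily (fun s => p (y, s)) d := fun y => hp.comp (by fun_prop)
  have harc : ∀ y, ∀ a : ℂ, ∃ α : I → ℂ, a ∈ (p (y, 0)).roots →
      RootArc (fun s => p (y, s)) α ∧ α 0 = a := by
    intro y a
    by_cases ha : a ∈ (p (y, 0)).roots
    · obtain ⟨g, hg, hgap⟩ := (h y).exists_gap hδ
      obtain ⟨α, hα⟩ := exists_rootArc (hfam y) hg hgap (s₀ := 0) ha
      exact ⟨α, fun _ => hα⟩
    · exact ⟨0, fun h => absurd h ha⟩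
  choose arc harc using harc
  set T : Y → ℂ → ℂ := fun y a => arc y a 1 with hT
  set A : Y → Finset ℂ := fun y => (p (y, 0)).roots.toFinset with hAdef
  have hmem : ∀ y a, a ∈ A y ↔ a ∈ (p (y, 0)).roots := fun y a => Multiset.mem_toFinset
  have hA : ∀ y, (A y).Nonempty := by
    intro y
    obtain ⟨a, ha⟩ := Multiset.card_pos_iff_exists_mem.1
      (by rw [hp.card_roots]; exact Nat.pos_of_ne_zero hd : 0 < (p (y, 0)).roots.card)
    exact ⟨a, (hmem y a).2 ha⟩
  have hclose : ∀ y₀, ∀ κ > 0, ∀ᶠ y in 𝓝 y₀,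
      (∀ a ∈ A y₀, ∃ b ∈ A y, ‖b - a‖ < κ ∧ ‖(T y b - b) - (T y₀ a - a)‖ < κ) ∧
      ∀ b ∈ A y, ∃ a ∈ A y₀, ‖b - a‖ < κ ∧ ‖(T y b - b) - (T y₀ a - a)‖ < κ := by
    intro y₀ κ hκ
    obtain ⟨g, hg, hgap⟩ := (h y₀).exists_gap hδ
    have hκ' : 0 < min (κ / 2) (g / 2) := lt_min (by positivity) (by positivity)
    filter_upwards [hp.eventually_forall_roots_near y₀ hκ'] with y hy
    have key : ∀ a ∈ A y₀, ∀ b ∈ A y, ‖b - a‖ < min (κ / 2) (g / 2) →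
        ‖b - a‖ < κ ∧ ‖(T y b - b) - (T y₀ a - a)‖ < κ := by
      intro a ha b hb hab
      obtain ⟨hα, hα0⟩ := harc y₀ a ((hmem _ _).1 ha)
      obtain ⟨hβ, hβ0⟩ := harc y b ((hmem _ _).1 hb)
      have h1 := RootArc.norm_sub_lt_of_near hgap
        (by linarith [min_le_right (κ / 2) (g / 2)]) (fun s => (hy s).1) hα hβ
        (by rwa [hα0, hβ0])
      have h2 := min_le_left (κ / 2) (g / 2)
      refine ⟨by linarith, ?_⟩
      have : (T y b - b) - (T y₀ a - a) = (arc y b 1 - arc y₀ a 1) - (b - a) := by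
        simp only [hT]; ring
      rw [this]
      linarith [norm_sub_le (arc y b 1 - arc y₀ a 1) (b - a)]
    refine ⟨fun a ha => ?_, fun b hb => ?_⟩
    · obtain ⟨b, hb, hab⟩ := (hy 0).2 a ((hmem _ _).1 ha)
      exact ⟨b, (hmem _ _).2 hb, key a ha b ((hmem _ _).2 hb) hab⟩
    · obtain ⟨a, ha, hab⟩ := (hy 0).1 b ((hmem _ _).1 hb)
      exact ⟨a, (hmem _ _).2 ha, key a ((hmem _ _).2 ha) b hb hab⟩
  have hTlip : ∀ y, ∀ a ∈ A y, ∀ b ∈ A y,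
      ‖(T y b - b) - (T y a - a)‖ ≤ L * ‖b - a‖ := by
    intro y a ha b hb
    obtain ⟨hα, hα0⟩ := harc y a ((hmem _ _).1 ha)
    obtain ⟨hβ, hβ0⟩ := harc y b ((hmem _ _).1 hb)
    have := RootArc.norm_sub_sub_le (hfam y) (h y) hL1 hδ0 hδ hδL hβ hα
    rw [hα0, hβ0] at this
    convert this using 2
    simp only [hT]; ring
  have hre : ∀ x y : ℂ, |x.re - y.re| ≤ ‖x - y‖ := fun x y => by
    simpa using Complex.abs_re_le_norm (x - y)
  have him : ∀ x y : ℂ, |x.im - y.im| ≤ ‖x - y‖ := fun x y => by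
    simpa using Complex.abs_im_le_norm (x - y)
  have hc : ∀ φ : ℂ → ℝ, (∀ x y, |φ x - φ y| ≤ ‖x - y‖) →
      Continuous fun x : Y × ℂ => mcShane L (A x.1) (hA x.1) (fun a => φ (T x.1 a - a)) x.2 := by
    intro φ hφ
    refine continuous_mcShane hL.le hA (v := fun y a => φ (T y a - a)) fun y₀ κ hκ => ?_
    filter_upwards [hclose y₀ κ hκ] with y hy
    exact ⟨fun a ha => (hy.1 a ha).imp fun b hb => ⟨hb.1, hb.2.1, (hφ _ _).trans_lt hb.2.2⟩,
      fun a ha => (hy.2 a ha).imp fun b hb => ⟨hb.1, hb.2.1, (hφ _ _).trans_lt hb.2.2⟩⟩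
  refine ⟨fun x => mcShane L (A x.1) (hA x.1) (fun a => (T x.1 a - a).re) x.2 +
    mcShane L (A x.1) (hA x.1) (fun a => (T x.1 a - a).im) x.2 * Complex.I, ?_, ?_, ?_⟩
  · exact (Complex.continuous_ofReal.comp (hc _ hre)).add
      ((Complex.continuous_ofReal.comp (hc _ him)).mul continuous_const)
  · intro y z w
    have h1 := abs_mcShane_sub_le hL.le (hA y) (fun a => (T y a - a).re) z w
    have h2 := abs_mcShane_sub_le hL.le (hA y) (fun a => (T y a - a).im) z w
    rw [add_sub_add_comm, ← sub_mul, ← Complex.ofReal_sub, ← Complex.ofReal_sub]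
    refine (norm_add_le _ _).trans ?_
    rw [norm_mul, Complex.norm_I, mul_one, Complex.norm_real, Complex.norm_real,
      Real.norm_eq_abs, Real.norm_eq_abs]
    linarith
  · intro y α hα
    have hα0 : α 0 ∈ A y := (hmem _ _).2 (hα.mem_roots 0)
    have hT1 : T y (α 0) = α 1 := by
      obtain ⟨hβ, hβ0⟩ := harc y (α 0) (hα.mem_roots 0)
      have := RootArc.norm_sub_sub_le (hfam y) (h y) hL1 hδ0 hδ hδL hβ hα
      rw [hβ0, sub_self, norm_zero, mul_zero, sub_zero, norm_le_zero_iff, sub_eq_zero] at this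
      exact this
    simp only
    rw [mcShane_eq (v := fun a => (T y a - a).re) (hA y) hα0 fun a ha =>
        (hre _ _).trans (hTlip y a ha _ hα0),
      mcShane_eq (v := fun a => (T y a - a).im) (hA y) hα0 fun a ha =>
        (him _ _).trans (hTlip y a ha _ hα0), hT1]
    exact Complex.re_add_im _

end Displacement

/-- Adding a fiberwise contracting displacement is a homeomorphism. -/
theorem exists_homeomorph_add {Y : Type*} [TopologicalSpace Y] {η : Y × ℂ → ℂ}
    (hη : Continuous η) (hlip : ∀ y z w, ‖η (y, z) - η (y, w)‖ ≤ 1 / 2 * ‖z - w‖) :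
    ∃ Ψ : Y × ℂ ≃ₜ Y × ℂ, ∀ x, Ψ x = (x.1, x.2 + η x) := by
  have hexp : ∀ y z w, ‖z - w‖ ≤ 2 * ‖(z + η (y, z)) - (w + η (y, w))‖ := by
    intro y z w
    have h1 := hlip y z w
    have h2 : z - w = ((z + η (y, z)) - (w + η (y, w))) - (η (y, z) - η (y, w)) := by ring
    have h3 := norm_sub_le ((z + η (y, z)) - (w + η (y, w))) (η (y, z) - η (y, w))
    rw [← h2] at h3
    linarith
  have hsurj : ∀ y u, ∃ z, z + η (y, z) = u := by
    intro y u
    have hcon : ContractingWith (1 / 2) fun z => u - η (y, z) := by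
      refine ⟨by rw [← NNReal.coe_lt_coe]; norm_num, LipschitzWith.of_dist_le_mul fun z w => ?_⟩
      rw [dist_eq_norm, dist_eq_norm, sub_sub_sub_cancel_left, norm_sub_rev]
      simpa using hlip y z w
    refine ⟨hcon.fixedPoint, ?_⟩
    have := hcon.fixedPoint_isFixedPt
    rw [Function.IsFixedPt, sub_eq_iff_eq_add] at this
    exact this.symm
  choose ζ hζ using hsurj
  have hζc : Continuous fun x : Y × ℂ => ζ x.1 x.2 := by
    refine continuous_iff_continuousAt.2 fun ⟨y₀, u₀⟩ => ?_
    rw [ContinuousAt, tendsto_iff_norm_sub_tendsto_zero]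
    have hlim : Tendsto (fun x : Y × ℂ => 2 * ‖x.2 - (ζ y₀ u₀ + η (x.1, ζ y₀ u₀))‖)
        (𝓝 (y₀, u₀)) (𝓝 0) := by
      refine Continuous.tendsto' (by fun_prop) _ _ ?_
      simp [hζ]
    refine squeeze_zero (fun _ => norm_nonneg _) (fun x => ?_) hlim
    have := hexp x.1 (ζ x.1 x.2) (ζ y₀ u₀)
    rwa [hζ] at this
  refine ⟨⟨⟨fun x => (x.1, x.2 + η x), fun x => (x.1, ζ x.1 x.2), fun x => ?_, fun x => ?_⟩,
    by fun_prop, by fun_prop⟩, fun x => rfl⟩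
  · refine Prod.ext rfl ?_
    have := hexp x.1 (ζ x.1 (x.2 + η x)) x.2
    rw [hζ, Prod.mk.eta, sub_self, norm_zero, mul_zero, norm_le_zero_iff, sub_eq_zero] at this
    exact this
  · exact Prod.ext rfl (hζ _ _)

theorem RootArc.eq_of_apply_eq {q : I → ℂ[X]} {g : ℝ} (hg : 0 < g) (hgap : RootGap q g)
    {α β : I → ℂ} (hα : RootArc q α) (hβ : RootArc q β) {s : I} (h : α s = β s) : α = β := by
  have hcα := hα.continuous
  have hcβ := hβ.continuous
  have hset : {s | α s = β s} = {s | ‖α s - β s‖ < g} := by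
    ext s
    exact ⟨fun h => by simpa [sub_eq_zero.2 h] using hg,
      fun h => eq_of_norm_sub_lt_gap hgap (hα.mem_roots s) (hβ.mem_roots s) h⟩
  have hclopen : IsClopen {s | α s = β s} :=
    ⟨isClosed_eq hcα hcβ, by rw [hset]; exact isOpen_lt (by fun_prop) continuous_const⟩
  have := hclopen.eq_univ ⟨s, h⟩
  funext s
  exact Set.eq_univ_iff_forall.1 this s

theorem PolyFamily.continuous_eval_iterate_derivative {Z : Type*} [TopologicalSpace Z]
    {p : Z → ℂ[X]} {d : ℕ} (hp : PolyFamily p d) {g : Z → ℂ} (hg : Continuous g) (k : ℕ) :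
    Continuous fun z => (derivative^[k] (p z)).eval (g z) := by
  have : (fun z => (derivative^[k] (p z)).eval (g z)) =
      fun z => ∑ i ∈ Finset.range (d + 1), (derivative^[k] (p z)).coeff i * g z ^ i := by
    funext z
    refine eval_eq_sum_range' (Nat.lt_succ_of_le ?_) _
    exact (natDegree_iterate_derivative _ _).trans (by rw [hp.natDegree_eq]; exact Nat.sub_le _ _)
  rw [this]
  refine continuous_finsetSum _ fun i _ => ?_
  simp only [coeff_iterate_derivative]
  exact ((hp.continuous_coeff _).const_smul _).mul (hg.pow i)

theorem PolyFamily.eventually_rootMultiplicity_le {Z : Type*} [TopologicalSpace Z]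
    {p : Z → ℂ[X]} {d : ℕ} (hp : PolyFamily p d) {g : Z → ℂ} (hg : Continuous g) (z₀ : Z) :
    ∀ᶠ z in 𝓝 z₀, (p z).rootMultiplicity (g z) ≤ (p z₀).rootMultiplicity (g z₀) := by
  set k := (p z₀).rootMultiplicity (g z₀) with hk
  have hclosed : IsClosed {z | k < (p z).rootMultiplicity (g z)} := by
    have : {z | k < (p z).rootMultiplicity (g z)} =
        ⋂ m ∈ Set.Iic k, {z | (derivative^[m] (p z)).eval (g z) = 0} := by
      ext z
      simp [lt_rootMultiplicity_iff_isRoot_iterate_derivative (hp.ne_zero z), IsRoot]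
    rw [this]
    exact isClosed_biInter fun m _ =>
      isClosed_eq (hp.continuous_eval_iterate_derivative hg m) continuous_const
  filter_upwards [hclosed.isOpen_compl.mem_nhds (by simp [← hk] : z₀ ∈ _)] with z hz
  exact not_lt.1 hz

/-- A family of polynomials over `[0, 1]` with a root gap factors along root arcs, with
constant multiplicities. -/
theorem PolyFamily.exists_eval_eq_prod_arcs {G : I → ℂ[X]} {e : ℕ} (hG : PolyFamily G e) {g : ℝ}
    (hg : 0 < g) (hgap : RootGap G g) :
    ∃ (A : Finset ℂ) (arc : ℂ → I → ℂ) (m : ℂ → ℕ), (∀ a ∈ A, RootArc G (arc a)) ∧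
      ∑ a ∈ A, m a = e ∧
      ∀ s z, (G s).eval z = (G s).leadingCoeff * ∏ a ∈ A, (z - arc a s) ^ m a := by
  have harc : ∀ a : ℂ, ∃ α : I → ℂ, a ∈ (G 0).roots → RootArc G α ∧ α 0 = a := by
    intro a
    by_cases ha : a ∈ (G 0).roots
    · obtain ⟨α, hα⟩ := exists_rootArc hG hg hgap (s₀ := 0) ha
      exact ⟨α, fun _ => hα⟩
    · exact ⟨0, fun h => absurd h ha⟩
  choose arc harc using harc
  set A := (G 0).roots.toFinset
  have hA : ∀ a ∈ A, RootArc G (arc a) ∧ arc a 0 = a := fun a ha =>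
    harc a (Multiset.mem_toFinset.1 ha)
  have hmaps : ∀ s, ∀ a ∈ A, arc a s ∈ (G s).roots.toFinset := fun s a ha =>
    Multiset.mem_toFinset.2 ((hA a ha).1.mem_roots s)
  have hinj : ∀ s, Set.InjOn (fun a => arc a s) A := by
    intro s a ha b hb hab
    have := RootArc.eq_of_apply_eq hg hgap (hA a ha).1 (hA b hb).1 hab
    rw [← (hA a ha).2, ← (hA b hb).2, this]
  have hsurj : ∀ s, Set.SurjOn (fun a => arc a s) A (G s).roots.toFinset := by
    intro s b hb
    obtain ⟨β, hβ, hβs⟩ := exists_rootArc hG hg hgap (Multiset.mem_toFinset.1 hb)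
    have hβA : β 0 ∈ A := Multiset.mem_toFinset.2 (hβ.mem_roots 0)
    refine ⟨β 0, hβA, ?_⟩
    rw [← hβs]
    exact congrFun (RootArc.eq_of_apply_eq hg hgap (hA _ hβA).1 hβ (s := 0) (hA _ hβA).2) s
  have hsum : ∀ s, ∑ a ∈ A, (G s).rootMultiplicity (arc a s) = e := by
    intro s
    rw [Finset.sum_nbij (t := (G s).roots.toFinset) (g := fun b => (G s).roots.count b)
      (fun a => arc a s) (hmaps s) (hinj s) (hsurj s) (fun a _ => (count_roots _).symm),
      Multiset.toFinset_sum_count_eq, hG.card_roots]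
  have hconst : ∀ a ∈ A, ∀ s, (G s).rootMultiplicity (arc a s) =
      (G 0).rootMultiplicity (arc a 0) := by
    intro a ha s
    have hloc : IsLocallyConstant fun s => (G s).rootMultiplicity (arc a s) := by
      refine IsLocallyConstant.iff_eventually_eq _ |>.2 fun s₀ => ?_
      have : ∀ᶠ s in 𝓝 s₀, ∀ b ∈ A, (G s).rootMultiplicity (arc b s) ≤
          (G s₀).rootMultiplicity (arc b s₀) :=
        (eventually_all_finset _).2 fun b hb =>
          hG.eventually_rootMultiplicity_le (hA b hb).1.continuous s₀
      filter_upwards [this] with s hs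
      exact (Finset.sum_eq_sum_iff_of_le hs).1 ((hsum s).trans (hsum s₀).symm) a ha
    exact hloc.apply_eq_of_preconnectedSpace s 0
  refine ⟨A, arc, fun a => (G 0).rootMultiplicity (arc a 0), fun a ha => (hA a ha).1, hsum 0,
    fun s z => ?_⟩
  rw [(IsAlgClosed.splits (G s)).eval_eq_prod_roots z, Finset.prod_multiset_map_count]
  congr 1
  refine (Finset.prod_nbij (fun a => arc a s) (hmaps s) (hinj s) (hsurj s) fun a ha => ?_).symm
  rw [count_roots, hconst a ha s]

theorem norm_mul_sub_mul_le {x y x' y' : ℂ} {κ κ' : ℝ} (hκ : 1 ≤ κ)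
    (h : ‖x - y‖ ≤ (κ - 1) * ‖y‖) (h' : ‖x' - y'‖ ≤ (κ' - 1) * ‖y'‖) :
    ‖x * x' - y * y'‖ ≤ (κ * κ' - 1) * ‖y * y'‖ := by
  have h1 : x * x' - y * y' = (x - y) * (x' - y') + (x - y) * y' + y * (x' - y') := by ring
  have h2 : ‖x * x' - y * y'‖ ≤ ‖x - y‖ * ‖x' - y'‖ + ‖x - y‖ * ‖y'‖ + ‖y‖ * ‖x' - y'‖ := by
    rw [h1]
    exact (norm_add₃_le).trans (by simp)
  rw [norm_mul]
  have h3 : ‖x - y‖ * ‖x' - y'‖ ≤ ((κ - 1) * ‖y‖) * ((κ' - 1) * ‖y'‖) :=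
    mul_le_mul h h' (norm_nonneg _) (mul_nonneg (by linarith) (norm_nonneg _))
  have h4 : ‖x - y‖ * ‖y'‖ ≤ ((κ - 1) * ‖y‖) * ‖y'‖ :=
    mul_le_mul_of_nonneg_right h (norm_nonneg _)
  have h5 : ‖y‖ * ‖x' - y'‖ ≤ ‖y‖ * ((κ' - 1) * ‖y'‖) :=
    mul_le_mul_of_nonneg_left h' (norm_nonneg _)
  linarith

theorem norm_pow_sub_pow_le {x y : ℂ} {κ : ℝ} (hκ : 1 ≤ κ) (h : ‖x - y‖ ≤ (κ - 1) * ‖y‖)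
    (m : ℕ) : ‖x ^ m - y ^ m‖ ≤ (κ ^ m - 1) * ‖y ^ m‖ := by
  induction m with
  | zero => simp
  | succ m ih =>
    rw [pow_succ, pow_succ y, pow_succ κ]
    exact norm_mul_sub_mul_le (one_le_pow₀ hκ) ih h

theorem norm_prod_pow_sub_prod_pow_le {ι : Type*} (A : Finset ι) {x y : ι → ℂ} (m : ι → ℕ)
    {κ : ℝ} (hκ : 1 ≤ κ) (h : ∀ a ∈ A, ‖x a - y a‖ ≤ (κ - 1) * ‖y a‖) :
    ‖∏ a ∈ A, x a ^ m a - ∏ a ∈ A, y a ^ m a‖ ≤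
      (κ ^ (∑ a ∈ A, m a) - 1) * ‖∏ a ∈ A, y a ^ m a‖ := by
  classical
  induction A using Finset.induction_on with
  | empty => simp
  | insert a A ha ih =>
    rw [Finset.prod_insert ha, Finset.prod_insert ha, Finset.sum_insert ha, pow_add]
    exact norm_mul_sub_mul_le (one_le_pow₀ hκ)
      (norm_pow_sub_pow_le hκ (h a (Finset.mem_insert_self _ _)) _)
      (ih fun b hb => h b (Finset.mem_insert_of_mem hb))

/-- Moving by a displacement which follows the roots changes values relatively little. -/
theorem norm_eval_add_sub_eval_le {G : I → ℂ[X]} {e : ℕ} (hG : PolyFamily G e) {g : ℝ}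
    (hg : 0 < g) (hgap : RootGap G g) {L κ : ℝ} (hL : 0 ≤ L) (hκ : 1 ≤ κ)
    (hlead : ‖(G 1).leadingCoeff - (G 0).leadingCoeff‖ ≤ (κ - 1) * ‖(G 0).leadingCoeff‖)
    {η : ℂ → ℂ} (hη : ∀ z w, ‖η z - η w‖ ≤ L * ‖z - w‖)
    (hηα : ∀ α, RootArc G α → η (α 0) = α 1 - α 0) (z : ℂ) :
    ‖(G 1).eval (z + η z) - (G 0).eval z‖ ≤ (κ * (1 + L) ^ e - 1) * ‖(G 0).eval z‖ := by
  obtain ⟨A, arc, m, hA, hm, hev⟩ := hG.exists_eval_eq_prod_arcs hg hgap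
  rw [hev, hev, ← hm]
  refine norm_mul_sub_mul_le hκ hlead (norm_prod_pow_sub_prod_pow_le A m (by linarith) ?_)
  intro a ha
  have h1 := hη z (arc a 0)
  rw [hηα _ (hA a ha)] at h1
  rw [add_sub_cancel_left]
  refine le_trans (le_of_eq ?_) h1
  congr 1
  ring

theorem norm_coeff_prod_X_sub_C_le (m : Multiset ℂ) (k : ℕ) :
    ‖(m.map fun a => X - C a).prod.coeff k‖ ≤
      ((m.map fun a => (X + C ‖a‖ : ℝ[X])).prod).coeff k := by
  induction m using Multiset.induction_on generalizing k with
  | empty => simp [coeff_one]; split_ifs <;> simp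
  | cons a m ih =>
    rw [Multiset.map_cons, Multiset.prod_cons, Multiset.map_cons, Multiset.prod_cons, sub_mul,
      add_mul, coeff_sub, coeff_add, coeff_C_mul, coeff_C_mul]
    refine (norm_sub_le _ _).trans (add_le_add ?_ ?_)
    · cases k with
      | zero => simp
      | succ k => simpa only [coeff_X_mul] using ih k
    · rw [norm_mul]
      exact mul_le_mul_of_nonneg_left (ih k) (norm_nonneg _)

theorem sum_norm_coeff_mul_pow_le (q : ℂ[X]) {r : ℝ} (hr : 0 ≤ r) :
    ∑ k ∈ Finset.range (q.natDegree + 1), ‖q.coeff k‖ * r ^ k ≤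
      ‖q.leadingCoeff‖ * (q.roots.map fun a => r + ‖a‖).prod := by
  set Q : ℝ[X] := (q.roots.map fun a => (X + C ‖a‖ : ℝ[X])).prod with hQ
  have hdeg : Q.natDegree < q.natDegree + 1 := by
    rw [(IsAlgClosed.splits q).natDegree_eq_card_roots, hQ, Nat.lt_succ_iff]
    refine (natDegree_multiset_prod_le _).trans (le_of_eq ?_)
    simp [Multiset.map_map]
  have heval : (q.roots.map fun a => r + ‖a‖).prod = Q.eval r := by
    rw [hQ, eval_multiset_prod, Multiset.map_map]
    simp
  rw [heval, eval_eq_sum_range' hdeg, Finset.mul_sum]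
  refine Finset.sum_le_sum fun k _ => ?_
  rw [← mul_assoc]
  refine mul_le_mul_of_nonneg_right ?_ (pow_nonneg hr k)
  conv_lhs => rw [(IsAlgClosed.splits q).eq_prod_roots, coeff_C_mul, norm_mul]
  exact mul_le_mul_of_nonneg_left (norm_coeff_prod_X_sub_C_le _ _) (norm_nonneg _)

/-- Relatively close coefficients have relatively close roots. -/
theorem exists_root_near_of_coeff_near {q q' : ℂ[X]} (hq : q ≠ 0)
    (hdeg : q'.natDegree ≤ q.natDegree) {ε θ : ℝ} (hθ : 0 < θ) (hε : ε < θ ^ q.natDegree)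
    (hcoeff : ∀ k, ‖q'.coeff k - q.coeff k‖ ≤ ε * ‖q.coeff k‖) {w' : ℂ}
    (hw' : q'.eval w' = 0) : ∃ w ∈ q.roots, ‖w' - w‖ ≤ θ * (‖w'‖ + ‖w‖) := by
  by_contra! hcon
  have hpos : ∀ w ∈ q.roots, 0 < ‖w'‖ + ‖w‖ := by
    intro w hw
    have h1 := hcon w hw
    by_contra! h
    nlinarith [norm_sub_le w' w, norm_nonneg w', norm_nonneg w]
  have hprod : 0 < (q.roots.map fun w => ‖w'‖ + ‖w‖).prod := by
    refine Multiset.prod_pos fun x hx => ?_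
    obtain ⟨w, hw, rfl⟩ := Multiset.mem_map.1 hx
    exact hpos w hw
  have h1 := leadingCoeff_mul_prod_le_norm_eval (p := q) (b := w')
    (r := fun w => θ * (‖w'‖ + ‖w‖)) fun w hw => ⟨by positivity, (hcon w hw).le⟩
  rw [Multiset.prod_map_mul, Multiset.map_const', Multiset.prod_replicate,
    ← (IsAlgClosed.splits q).natDegree_eq_card_roots] at h1
  have h2 : ‖q.eval w'‖ = ‖(q' - q).eval w'‖ := by
    rw [eval_sub, hw', zero_sub, norm_neg]
  have h3 := norm_eval_le_sum (q := q' - q) (d := q.natDegree)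
    ((natDegree_sub_le _ _).trans (max_le hdeg le_rfl)) w'
  have h4 : ∑ k ∈ Finset.range (q.natDegree + 1), ‖(q' - q).coeff k‖ * ‖w'‖ ^ k ≤
      ε * ∑ k ∈ Finset.range (q.natDegree + 1), ‖q.coeff k‖ * ‖w'‖ ^ k := by
    rw [Finset.mul_sum]
    refine Finset.sum_le_sum fun k _ => ?_
    rw [coeff_sub, ← mul_assoc]
    exact mul_le_mul_of_nonneg_right (hcoeff k) (by positivity)
  have hlead : 0 < ‖q.leadingCoeff‖ := by simpa using hq
  have hε0 : 0 ≤ ε := by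
    have := (norm_nonneg _).trans (hcoeff q.natDegree)
    exact nonneg_of_mul_nonneg_left this hlead
  have h5 := mul_le_mul_of_nonneg_left (sum_norm_coeff_mul_pow_le q (norm_nonneg w')) hε0
  have h6 : θ ^ q.natDegree * (‖q.leadingCoeff‖ * (q.roots.map fun w => ‖w'‖ + ‖w‖).prod) ≤
      ε * (‖q.leadingCoeff‖ * (q.roots.map fun w => ‖w'‖ + ‖w‖).prod) := by linarith
  exact absurd (le_of_mul_le_mul_right h6 (mul_pos hlead hprod)) (not_le.2 hε)

/-- The polynomial whose roots are the differences of roots of `P`, up to a scalar. -/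
def diffPoly {R : Type*} [CommRing R] (P : R[X]) (d : ℕ) : R[X] :=
  resultant (P.map C) ((P.map C).comp (X + C X)) d d

theorem map_diffPoly {R : Type*} [CommRing R] (P : R[X]) {d : ℕ} (φ : R →+* ℂ)
    (hd : (P.map φ).natDegree = d) :
    (diffPoly P d).map φ = C (P.map φ).leadingCoeff ^ d *
      ((P.map φ).roots.map fun a => (P.map φ).comp (X + C a)).prod := by
  set p := P.map φ with hp
  have hmap : (P.map C).map (mapRingHom φ) = p.map C := by
    rw [hp, Polynomial.map_map, Polynomial.map_map]
    congr 1
    ext x : 1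
    simp
  have hnat : (p.map (C : ℂ →+* ℂ[X])).natDegree = d := by
    rw [natDegree_map_eq_of_injective C_injective, hd]
  rw [← coe_mapRingHom, diffPoly, ← resultant_map_map, Polynomial.map_comp, hmap]
  have := resultant_eq_prod_eval (p.map C)
    ((p.map C).comp ((X + C X : ℂ[X][X]))) d (natDegree_comp_le.trans (by
      rw [hnat, natDegree_X_add_C, mul_one])) ((IsAlgClosed.splits p).map C)
  rw [hnat, leadingCoeff_map_of_injective C_injective, (IsAlgClosed.splits p).roots_map,
    Multiset.map_map] at this
  have hX : (X + C X : R[X][X]).map (mapRingHom φ) = X + C X := by simp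
  rw [hX, this]
  congr 2
  refine Multiset.map_congr rfl fun a _ => ?_
  simp only [Function.comp_apply, eval_comp, eval_add, eval_X, eval_C]
  rw [add_comm, eval_map, comp]

section

variable {R : Type*} [CommRing R] (P : R[X]) {d : ℕ} (φ : R →+* ℂ)

theorem map_diffPoly_ne_zero (hd : (P.map φ).natDegree = d) (h0 : P.map φ ≠ 0) :
    (diffPoly P d).map φ ≠ 0 := by
  rw [map_diffPoly P φ hd]
  refine mul_ne_zero (pow_ne_zero _ (by simpa using h0)) (Multiset.prod_ne_zero fun h => ?_)
  obtain ⟨a, -, ha⟩ := Multiset.mem_map.1 h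
  refine h0 ((comp_eq_zero_iff.1 ha).resolve_right fun h => ?_)
  have := congrArg natDegree h.2
  simp at this

theorem natDegree_map_diffPoly (hd : (P.map φ).natDegree = d) (h0 : P.map φ ≠ 0) :
    ((diffPoly P d).map φ).natDegree = d * d := by
  rw [map_diffPoly P φ hd, ← C_pow, natDegree_C_mul (pow_ne_zero _ (by simpa using h0)),
    natDegree_multiset_prod]
  · simp [Multiset.map_map, natDegree_comp, hd,
      ← (IsAlgClosed.splits (P.map φ)).natDegree_eq_card_roots]
  · intro h
    obtain ⟨a, -, ha⟩ := Multiset.mem_map.1 h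
    refine h0 ((comp_eq_zero_iff.1 ha).resolve_right fun h => ?_)
    have := congrArg natDegree h.2
    simp at this

theorem eval_map_diffPoly_eq_zero_iff (hd : (P.map φ).natDegree = d) (h0 : P.map φ ≠ 0) (w : ℂ) :
    ((diffPoly P d).map φ).eval w = 0 ↔
      ∃ a ∈ (P.map φ).roots, ∃ b ∈ (P.map φ).roots, b - a = w := by
  rw [map_diffPoly P φ hd, ← C_pow, eval_mul, eval_C, mul_eq_zero,
    or_iff_right (pow_ne_zero _ (by simpa using h0)), eval_multiset_prod, Multiset.map_map,
    Multiset.prod_eq_zero_iff, Multiset.mem_map]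
  refine exists_congr fun a => and_congr_right fun ha => ?_
  simp only [Function.comp_apply, eval_comp, eval_add, eval_X, eval_C]
  constructor
  · intro h
    exact ⟨w + a, mem_roots'.2 ⟨h0, h⟩, by ring⟩
  · rintro ⟨b, hb, rfl⟩
    simpa using (mem_roots'.1 hb).2

variable {φ} {φ' : R →+* ℂ}

/-- If the coefficients of `diffPoly P d` take relatively close values, then so do the
differences of the roots of `P`. -/
theorem exists_sub_near_of_diffPoly_near (hd : (P.map φ).natDegree = d) (h0 : P.map φ ≠ 0)
    (hd' : (P.map φ').natDegree = d) (h0' : P.map φ' ≠ 0) {ε θ : ℝ} (hθ : 0 < θ)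
    (hθ1 : θ ≤ 1 / 2) (hε : ε < θ ^ (d * d))
    (hcoeff : ∀ k, ‖φ' ((diffPoly P d).coeff k) - φ ((diffPoly P d).coeff k)‖ ≤
      ε * ‖φ ((diffPoly P d).coeff k)‖) {a b : ℂ}
    (ha : a ∈ (P.map φ').roots) (hb : b ∈ (P.map φ').roots) :
    ∃ a' ∈ (P.map φ).roots, ∃ b' ∈ (P.map φ).roots,
      ‖(a - b) - (a' - b')‖ ≤ 4 * θ * ‖a' - b'‖ := by
  obtain ⟨w, hw, hww⟩ := exists_root_near_of_coeff_near (q := (diffPoly P d).map φ)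
    (q' := (diffPoly P d).map φ') (map_diffPoly_ne_zero P φ hd h0)
    (by rw [natDegree_map_diffPoly P φ hd h0, natDegree_map_diffPoly P φ' hd' h0']) hθ
    (by rwa [natDegree_map_diffPoly P φ hd h0]) (fun k => by simpa only [coeff_map] using hcoeff k)
    ((eval_map_diffPoly_eq_zero_iff P φ' hd' h0' (a - b)).2 ⟨b, hb, a, ha, rfl⟩)
  obtain ⟨b', hb', a', ha', rfl⟩ :=
    (eval_map_diffPoly_eq_zero_iff P φ hd h0 w).1 (mem_roots'.1 hw).2
  refine ⟨a', ha', b', hb', ?_⟩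
  have h1 : ‖a - b‖ ≤ ‖(a - b) - (a' - b')‖ + ‖a' - b'‖ := by
    simpa using norm_add_le ((a - b) - (a' - b')) (a' - b')
  nlinarith [norm_nonneg ((a - b) - (a' - b')), norm_nonneg (a' - b')]

end

section Shear

variable {R : Type*} [CommRing R] {n : ℕ} (N : ℕ)

/-- The images of the variables under the shear `xᵢ ↦ xᵢ + x₀ ^ N ^ i`. -/
def shearVar (R : Type*) [CommRing R] (n N : ℕ) : Fin (n + 1) → (MvPolynomial (Fin n) R)[X] :=
  Fin.cons X fun i => X ^ N ^ (i.1 + 1) + C (MvPolynomial.X i)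

/-- The shear `xᵢ ↦ xᵢ + x₀ ^ N ^ i`, regarded as a polynomial in `x₀`. -/
def shearHom (R : Type*) [CommRing R] (n N : ℕ) :
    MvPolynomial (Fin (n + 1)) R →+* (MvPolynomial (Fin n) R)[X] :=
  MvPolynomial.eval₂Hom ((C : _ →+* (MvPolynomial (Fin n) R)[X]).comp MvPolynomial.C)
    (shearVar R n N)

variable {N}

theorem monic_shearVar (hN : N ≠ 0) (i : Fin (n + 1)) : (shearVar R n N i).Monic := by
  cases i using Fin.cases with
  | zero => exact monic_X
  | succ i => exact monic_X_pow_add_C _ (pow_ne_zero _ hN)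

theorem natDegree_shearVar [Nontrivial R] (i : Fin (n + 1)) :
    (shearVar R n N i).natDegree = N ^ i.1 := by
  cases i using Fin.cases with
  | zero => simp [shearVar]
  | succ i => simp [shearVar]

theorem shearHom_monomial (v : Fin (n + 1) →₀ ℕ) (a : R) :
    shearHom R n N (MvPolynomial.monomial v a) =
      C (MvPolynomial.C a) * ∏ i, shearVar R n N i ^ v i := by
  rw [shearHom, MvPolynomial.coe_eval₂Hom, MvPolynomial.eval₂_monomial, Finsupp.prod_fintype]
  · rfl
  · simp

theorem sum_pow_mul_injective {v w : Fin (n + 1) →₀ ℕ} (hN : 1 < N) (hv : ∀ i, v i < N)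
    (hw : ∀ i, w i < N) (h : ∑ i : Fin (n + 1), N ^ i.1 * v i = ∑ i : Fin (n + 1), N ^ i.1 * w i) :
    v = w := by
  refine Finsupp.ext <| congrFun <| List.ofFn_inj.mp ?_
  apply Nat.ofDigits_inj_of_len_eq hN (by simp)
    (by grind) (by grind)
  simpa only [Nat.ofDigits_eq_sum_mapIdx, List.mapIdx_eq_ofFn, List.get_ofFn, List.length_ofFn,
    Fin.val_cast, mul_comm, List.sum_ofFn] using! h

/-- After a shear of large degree, the leading coefficient in the first variable is constant. -/
theorem exists_leadingCoeff_shearHom [IsDomain R] {G : MvPolynomial (Fin (n + 1)) R} (hG : G ≠ 0)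
    (hN : 1 < N) (hGN : G.totalDegree < N) :
    ∃ l : R, l ≠ 0 ∧ (shearHom R n N G).leadingCoeff = MvPolynomial.C l := by
  have hmon : ∀ v : Fin (n + 1) →₀ ℕ, (∏ i, shearVar R n N i ^ v i).Monic := fun v =>
    monic_prod_of_monic _ _ fun i _ => (monic_shearVar (by omega) i).pow _
  have hdeg : ∀ v : Fin (n + 1) →₀ ℕ, ∀ a : R, a ≠ 0 →
      (shearHom R n N (MvPolynomial.monomial v a)).natDegree =
        ∑ i : Fin (n + 1), N ^ i.1 * v i := by
    intro v a ha
    rw [shearHom_monomial, natDegree_C_mul (by simpa using ha),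
      natDegree_prod_of_monic _ _ fun i _ => (monic_shearVar (by omega) i).pow _]
    refine Finset.sum_congr rfl fun i _ => ?_
    rw [(monic_shearVar (by omega) i).natDegree_pow, natDegree_shearVar, mul_comm]
  have hlead : ∀ v : Fin (n + 1) →₀ ℕ, ∀ a : R,
      (shearHom R n N (MvPolynomial.monomial v a)).leadingCoeff = MvPolynomial.C a := by
    intro v a
    rw [shearHom_monomial, leadingCoeff_mul, (hmon v).leadingCoeff, mul_one, leadingCoeff_C]
  obtain ⟨v, hv, hmax⟩ := Finset.exists_max_image G.support
    (fun v => ∑ i : Fin (n + 1), N ^ i.1 * v i) (MvPolynomial.support_nonempty.2 hG)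
  have hlt : ∀ w ∈ G.support, ∀ i, w i < N := fun w hw i =>
    ((MvPolynomial.monomial_le_degreeOf i hw).trans
      (MvPolynomial.degreeOf_le_totalDegree G i)).trans_lt hGN
  have hvc := MvPolynomial.mem_support_iff.1 hv
  refine ⟨G.coeff v, hvc, ?_⟩
  have hsplit : shearHom R n N G =
      (∑ w ∈ G.support \ {v}, shearHom R n N (MvPolynomial.monomial w (G.coeff w))) +
        shearHom R n N (MvPolynomial.monomial v (G.coeff v)) := by
    conv_lhs => rw [← G.support_sum_monomial_coeff]
    rw [map_sum, Finset.sum_eq_add_sum_sdiff_singleton_of_mem hv, add_comm]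
  have hne : shearHom R n N (MvPolynomial.monomial v (G.coeff v)) ≠ 0 := by
    rw [← leadingCoeff_ne_zero, hlead]
    simpa using hvc
  rw [hsplit, leadingCoeff_add_of_degree_lt, hlead]
  refine (degree_sum_le _ _).trans_lt
    ((Finset.sup_lt_iff (bot_lt_iff_ne_bot.2 (mt degree_eq_bot.1 hne))).2 fun w hw => ?_)
  obtain ⟨hw1, hw2⟩ := Finset.mem_sdiff.1 hw
  refine degree_lt_degree ?_
  rw [hdeg _ _ hvc, hdeg _ _ (MvPolynomial.mem_support_iff.1 hw1)]
  refine lt_of_le_of_ne (hmax w hw1) fun h => hw2 ?_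
  rw [Finset.mem_singleton]
  exact sum_pow_mul_injective hN (hlt w hw1) (hlt v hv) h

end Shear

/-- Evaluation of a polynomial whose coefficients depend polynomially on a parameter `t`. -/
def paramEval {n : ℕ} (t : ℂ) (x : Fin n → ℂ) : MvPolynomial (Fin n) ℂ[X] →+* ℂ :=
  MvPolynomial.eval₂Hom (evalRingHom t) x

theorem continuous_paramEval {n : ℕ} (G : MvPolynomial (Fin n) ℂ[X]) :
    Continuous fun q : ℂ × (Fin n → ℂ) => paramEval q.1 q.2 G := by
  induction G using MvPolynomial.induction_on with
  | C a =>
    simp only [paramEval, MvPolynomial.coe_eval₂Hom, MvPolynomial.eval₂_C, coe_evalRingHom]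
    exact a.continuous.comp continuous_fst
  | add p q hp hq =>
    simp only [map_add]
    exact hp.add hq
  | mul_X p i hp =>
    simp only [map_mul]
    refine hp.mul ?_
    simp only [paramEval, MvPolynomial.coe_eval₂Hom, MvPolynomial.eval₂_X]
    fun_prop

/-- The homeomorphism of affine space underlying `shearHom`. -/
def shearHomeomorph (n N : ℕ) : (Fin n → ℂ) × ℂ ≃ₜ (Fin (n + 1) → ℂ) where
  toFun q := Fin.cons q.2 fun i => q.2 ^ N ^ (i.1 + 1) + q.1 i
  invFun x := (fun i => x i.succ - x 0 ^ N ^ (i.1 + 1), x 0)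
  left_inv q := by simp
  right_inv x := by
    funext i
    cases i using Fin.cases <;> simp
  continuous_toFun := by
    refine continuous_pi fun i => ?_
    cases i using Fin.cases with
    | zero => simpa using continuous_snd
    | succ i => simpa using by fun_prop
  continuous_invFun := by fun_prop

theorem eval_map_shearHom {n N : ℕ} (t : ℂ) (q : (Fin n → ℂ) × ℂ)
    (G : MvPolynomial (Fin (n + 1)) ℂ[X]) :
    ((shearHom ℂ[X] n N G).map (paramEval t q.1)).eval q.2 =
      paramEval t (shearHomeomorph n N q) G := by
  have : ((evalRingHom q.2).comp (mapRingHom (paramEval t q.1))).comp (shearHom ℂ[X] n N) =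
      paramEval t (shearHomeomorph n N q) := by
    refine MvPolynomial.ringHom_ext (fun a => ?_) fun i => ?_
    · simp [shearHom, paramEval]
    · cases i using Fin.cases <;> simp [shearHom, shearVar, paramEval, shearHomeomorph]
  exact RingHom.congr_fun this G

/-- A polynomial with constant leading coefficient yields polynomials of constant degree away
from the zeros of this coefficient. -/
theorem polyFamily_map_paramEval {n : ℕ} {P : (MvPolynomial (Fin n) ℂ[X])[X]} {l : ℂ[X]}
    (hP : P.leadingCoeff = MvPolynomial.C l) {Z : Type*} [TopologicalSpace Z] {t : Z → ℂ}
    {x : Z → Fin n → ℂ} (ht : Continuous t) (hx : Continuous x) (hl : ∀ z, l.eval (t z) ≠ 0) :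
    PolyFamily (fun z => P.map (paramEval (t z) (x z))) P.natDegree := by
  have hne : ∀ z, paramEval (t z) (x z) P.leadingCoeff ≠ 0 := by
    intro z
    rw [hP]
    simpa [paramEval] using hl z
  refine ⟨fun k => ?_, fun z => natDegree_map_of_leadingCoeff_ne_zero _ (hne z), fun z h => ?_⟩
  · simp only [coeff_map]
    exact (continuous_paramEval (P.coeff k)).comp (g := fun q : ℂ × (Fin n → ℂ) =>
      paramEval q.1 q.2 (P.coeff k)) (f := fun z => (t z, x z)) (ht.prodMk hx)
  · have := leadingCoeff_map_of_leadingCoeff_ne_zero _ (hne z)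
    rw [h, leadingCoeff_zero] at this
    exact hne z this.symm

/-- Over the disc of radius `r` around `c`, affine space can be trivialized in such a way that
the values of all members of `𝓕` change by a relative error of at most `ε`. -/
def HasRelTrivialization {n : ℕ} (𝓕 : Finset (MvPolynomial (Fin n) ℂ[X])) (c : ℂ) (r ε : ℝ) :
    Prop :=
  ∃ Φ : Metric.ball c r × (Fin n → ℂ) ≃ₜ Metric.ball c r × (Fin n → ℂ),
    (∀ q, (Φ q).1 = q.1) ∧ ∀ G ∈ 𝓕, ∀ (t t' : Metric.ball c r) (x : Fin n → ℂ),
      ‖paramEval t (Φ (t, x)).2 G - paramEval t' (Φ (t', x)).2 G‖ ≤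
        ε * ‖paramEval t' (Φ (t', x)).2 G‖

/-- The radial contraction of a disc to its center. -/
def ballContraction {c : ℂ} {r : ℝ} (q : Metric.ball c r × I) : Metric.ball c r :=
  ⟨c + ((q.2 : ℝ) : ℂ) * (q.1 - c), by
    have h1 := q.1.2
    rw [mem_ball_iff_norm] at h1 ⊢
    rw [add_sub_cancel_left, norm_mul, Complex.norm_real, Real.norm_of_nonneg q.2.2.1]
    nlinarith [norm_nonneg ((q.1 : ℂ) - c), q.2.2.1, q.2.2.2]⟩

theorem continuous_ballContraction {c : ℂ} {r : ℝ} :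
    Continuous (ballContraction : Metric.ball c r × I → Metric.ball c r) :=
  Continuous.subtype_mk (by fun_prop) _

theorem ballContraction_one {c : ℂ} {r : ℝ} (t : Metric.ball c r) :
    ballContraction (t, 1) = t := by
  ext
  simp [ballContraction]

theorem ballContraction_zero {c : ℂ} {r : ℝ} (t t' : Metric.ball c r) :
    ballContraction (t, 0) = ballContraction (t', 0) := by
  ext
  simp [ballContraction]

theorem RootGap.of_dvd {Z : Type*} {p q : Z → ℂ[X]} {g : ℝ} (h : RootGap p g)
    (hp : ∀ s, p s ≠ 0) (hdvd : ∀ s, q s ∣ p s) : RootGap q g := fun s _ ha _ hb =>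
  h s _ (Multiset.mem_of_le (roots.le_of_dvd (hp s) (hdvd s)) ha) _
    (Multiset.mem_of_le (roots.le_of_dvd (hp s) (hdvd s)) hb)

theorem RootArc.of_dvd {Z : Type*} [TopologicalSpace Z] {p q : Z → ℂ[X]} {α : Z → ℂ}
    (h : RootArc q α) (hp : ∀ s, p s ≠ 0) (hdvd : ∀ s, q s ∣ p s) : RootArc p α :=
  ⟨h.continuous, fun s => Multiset.mem_of_le (roots.le_of_dvd (hp s) (hdvd s)) (h.mem_roots s)⟩

theorem norm_sub_le_of_common_near {x y b : ℂ} {ε : ℝ} (hε : ε ≤ 1 / 2)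
    (hx : ‖x - b‖ ≤ ε * ‖b‖) (hy : ‖y - b‖ ≤ ε * ‖b‖) : ‖x - y‖ ≤ 4 * ε * ‖y‖ := by
  have h1 : ‖x - y‖ ≤ ‖x - b‖ + ‖y - b‖ := by
    have := norm_sub_le (x - b) (y - b)
    rwa [sub_sub_sub_cancel_right] at this
  have h2 : ‖b‖ ≤ ‖y‖ + ‖y - b‖ := by
    have := norm_sub_le y (y - b)
    rwa [sub_sub_cancel] at this
  have h3 : ‖b‖ ≤ 2 * ‖y‖ := by nlinarith [norm_nonneg b]
  rcases (norm_nonneg b).eq_or_lt with hb | hb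
  · rw [← hb, mul_zero] at hx hy
    have hε' : ‖y‖ = 0 := by
      have hb0 : b = 0 := norm_eq_zero.1 hb.symm
      have := norm_le_zero_iff.1 hy
      rw [hb0, sub_zero] at this
      rw [this, norm_zero]
    rw [hε', mul_zero]
    linarith
  · have hε0 : 0 ≤ ε := nonneg_of_mul_nonneg_left ((norm_nonneg _).trans hx) hb
    nlinarith

section Step

variable {n N : ℕ} {𝓕 : Finset (MvPolynomial (Fin (n + 1)) ℂ[X])}

/-- The product of the sheared members of `𝓕` and of the first variable. -/
def shearProd (N : ℕ) (𝓕 : Finset (MvPolynomial (Fin (n + 1)) ℂ[X])) :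
    (MvPolynomial (Fin n) ℂ[X])[X] :=
  X * ∏ G ∈ 𝓕, shearHom ℂ[X] n N G

/-- The polynomials in one variable less which control the roots of the members of `𝓕`. -/
def controlFamily (N : ℕ) (𝓕 : Finset (MvPolynomial (Fin (n + 1)) ℂ[X])) :
    Finset (MvPolynomial (Fin n) ℂ[X]) :=
  open Classical in
  (diffPoly (shearProd N 𝓕) (shearProd N 𝓕).natDegree).coeffs ∪
    𝓕.image fun G => (shearHom ℂ[X] n N G).leadingCoeff

variable {l : MvPolynomial (Fin (n + 1)) ℂ[X] → ℂ[X]} {c : ℂ} {r : ℝ}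

theorem leadingCoeff_shearProd
    (hl : ∀ G ∈ 𝓕, (shearHom ℂ[X] n N G).leadingCoeff = MvPolynomial.C (l G)) :
    (shearProd N 𝓕).leadingCoeff = MvPolynomial.C (∏ G ∈ 𝓕, l G) := by
  rw [shearProd, leadingCoeff_mul, leadingCoeff_X, one_mul, leadingCoeff_prod, map_prod]
  exact Finset.prod_congr rfl hl

theorem HasRelTrivialization.succ
    (hl : ∀ G ∈ 𝓕, (shearHom ℂ[X] n N G).leadingCoeff = MvPolynomial.C (l G))
    (hr : ∀ t ∈ Metric.ball c r, ∀ G ∈ 𝓕, (l G).eval t ≠ 0) {d : ℕ}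
    (hd : (shearProd N 𝓕).natDegree = d) {ε ε' θ L : ℝ} (hθ : 0 < θ) (hθ1 : 4 * θ ≤ 1 / 2)
    (hL : L ≤ 1 / 4) (hθL : 8 * (4 * θ) * (d * d + 1) < L) (hε'θ : ε' < θ ^ (d * d))
    (hε'L : ε' ≤ L) (hε : ε ≤ 1 / 2) (hLε : (1 + L) * (1 + 2 * L) ^ d - 1 ≤ ε)
    (h : HasRelTrivialization (controlFamily N 𝓕) c r ε') :
    HasRelTrivialization 𝓕 c r (4 * ε) := by
  classical
  obtain ⟨Ψ, hΨ1, hΨ⟩ := h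
  have hL0 : 0 < L := lt_of_le_of_lt (by positivity) hθL
  set P := shearProd N 𝓕 with hP
  have hPl := leadingCoeff_shearProd hl
  rw [← hP] at hPl
  have hlP : ∀ t ∈ Metric.ball c r, (∏ G ∈ 𝓕, l G).eval t ≠ 0 := by
    intro t ht
    rw [eval_prod]
    exact Finset.prod_ne_zero_iff.2 (hr t ht)
  have hP0 : P ≠ 0 ∨ IsEmpty (Metric.ball c r) := by
    rcases isEmpty_or_nonempty (Metric.ball c r) with h | ⟨⟨t, ht⟩⟩
    · exact Or.inr h
    · refine Or.inl fun h => hlP t ht ?_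
      rw [h, leadingCoeff_zero] at hPl
      rw [(map_eq_zero_iff _ (MvPolynomial.C_injective _ _)).1 hPl.symm, eval_zero]
  have hfac : ∀ G ∈ 𝓕, shearHom ℂ[X] n N G ∣ P := fun G hG =>
    (Finset.dvd_prod_of_mem _ hG).trans (dvd_mul_left _ _)
  rcases hP0 with hP0 | hempty
  swap
  · exact ⟨Homeomorph.refl _, fun _ => rfl, fun _ _ t => hempty.elim t⟩
  have hd0 : d ≠ 0 := by
    have h1 : P = X * ∏ G ∈ 𝓕, shearHom ℂ[X] n N G := rfl
    rw [h1, natDegree_X_mul (right_ne_zero_of_mul (h1 ▸ hP0))] at hd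
    omega
  set Y := Metric.ball c r × (Fin n → ℂ) with hY
  set τ : Y × I → Metric.ball c r := fun q => ballContraction (q.1.1, q.2) with hτ
  have hτc : Continuous τ := continuous_ballContraction.comp
    ((continuous_fst.comp continuous_fst).prodMk continuous_snd)
  set ξ : Y × I → Fin n → ℂ := fun q => (Ψ (τ q, q.1.2)).2 with hξ
  have hξc : Continuous ξ := continuous_snd.comp
    (Ψ.continuous.comp (hτc.prodMk (continuous_snd.comp continuous_fst)))
  have hτc' : Continuous fun q => (τ q : ℂ) := continuous_subtype_val.comp hτc
  have hpP : PolyFamily (fun q => P.map (paramEval (τ q) (ξ q))) d := by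
    rw [← hd]
    exact polyFamily_map_paramEval hPl hτc' hξc fun q => hlP _ (τ q).2
  have hτ0 : ∀ (y : Y) s, ∀ G ∈ controlFamily N 𝓕,
      ‖paramEval (τ (y, s)) (ξ (y, s)) G - paramEval (τ (y, 0)) (ξ (y, 0)) G‖ ≤
        ε' * ‖paramEval (τ (y, 0)) (ξ (y, 0)) G‖ := fun y s G hG => hΨ G hG _ _ _
  have hcontrol : ∀ y, DiffControl (fun s => P.map (paramEval (τ (y, s)) (ξ (y, s))))
      (4 * θ) := by
    intro y s a ha b hb
    refine exists_sub_near_of_diffPoly_near P (hpP.natDegree_eq _) (hpP.ne_zero _)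
      (hpP.natDegree_eq _) (hpP.ne_zero _) hθ (by linarith) hε'θ (fun k => ?_) ha hb
    by_cases hk : (diffPoly P d).coeff k = 0
    · simp [hk]
    · refine hτ0 y s _ (Finset.mem_union_left _ ?_)
      rw [← hP, hd]
      exact coeff_mem_coeffs hk
  obtain ⟨η, hηc, hηL, hηα⟩ := exists_displacement hpP hd0 hcontrol (by linarith) (by positivity)
    hθ1 hθL
  obtain ⟨Θ, hΘ⟩ := exists_homeomorph_add hηc fun y z w => (hηL y z w).trans
    (mul_le_mul_of_nonneg_right (by linarith) (norm_nonneg _))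
  set E : Y × ℂ ≃ₜ Metric.ball c r × (Fin (n + 1) → ℂ) :=
    (Homeomorph.prodAssoc _ _ _).trans ((Homeomorph.refl _).prodCongr (shearHomeomorph n N))
    with hE
  set Φ := E.symm.trans (Θ.trans ((Ψ.prodCongr (Homeomorph.refl ℂ)).trans E)) with hΦ
  have hΦE : ∀ (t : Metric.ball c r) x' z, Φ (t, shearHomeomorph n N (x', z)) =
      (t, shearHomeomorph n N ((Ψ (t, x')).2, z + η ((t, x'), z))) := by
    intro t x' z
    have h1 : (t, shearHomeomorph n N (x', z)) = E ((t, x'), z) := rfl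
    rw [h1, hΦ, Homeomorph.trans_apply, Homeomorph.symm_apply_apply, Homeomorph.trans_apply, hΘ]
    refine Prod.ext ?_ rfl
    exact hΨ1 (t, x')
  refine ⟨Φ, fun ⟨t, x⟩ => ?_, fun G hG t t' x => ?_⟩
  · obtain ⟨⟨x', z⟩, rfl⟩ := (shearHomeomorph n N).surjective x
    rw [hΦE]
  obtain ⟨⟨x', z⟩, rfl⟩ := (shearHomeomorph n N).surjective x
  have key : ∀ u : Metric.ball c r,
      ‖paramEval u (Φ (u, shearHomeomorph n N (x', z))).2 G -
        ((shearHom ℂ[X] n N G).map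
          (paramEval (τ ((t, x'), 0)) (ξ ((t, x'), 0)))).eval z‖ ≤
      ε * ‖((shearHom ℂ[X] n N G).map
          (paramEval (τ ((t, x'), 0)) (ξ ((t, x'), 0)))).eval z‖ := by
    intro u
    have hu0 : τ ((t, x'), 0) = τ ((u, x'), 0) := ballContraction_zero t u
    have hξ0 : ξ ((t, x'), 0) = ξ ((u, x'), 0) := by simp only [hξ, hu0]
    have hu1 : τ ((u, x'), 1) = u := ballContraction_one u
    have hξ1 : ξ ((u, x'), 1) = (Ψ (u, x')).2 := by simp only [hξ, hu1]
    rw [hu0, hξ0, hΦE, ← eval_map_shearHom]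
    simp only
    set Gs : I → ℂ[X] := fun s =>
      (shearHom ℂ[X] n N G).map (paramEval (τ ((u, x'), s)) (ξ ((u, x'), s))) with hGs
    have hGfam : PolyFamily Gs (shearHom ℂ[X] n N G).natDegree :=
      polyFamily_map_paramEval (hl G hG) (t := fun s => (τ ((u, x'), s) : ℂ))
        (x := fun s => ξ ((u, x'), s)) (by fun_prop) (by fun_prop) fun s => hr _ (τ _).2 G hG
    have hne : ∀ s : I, P.map (paramEval (τ ((u, x'), s)) (ξ ((u, x'), s))) ≠ 0 := fun s =>
      hpP.ne_zero ((u, x'), s)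
    have hdvd : ∀ s : I, Gs s ∣ P.map (paramEval (τ ((u, x'), s)) (ξ ((u, x'), s))) := fun s =>
      Polynomial.map_dvd _ (hfac G hG)
    obtain ⟨g, hg, hgap⟩ := (hcontrol (u, x')).exists_gap hθ1
    have hleadG : ∀ s, (Gs s).leadingCoeff =
        paramEval (τ ((u, x'), s)) (ξ ((u, x'), s)) (shearHom ℂ[X] n N G).leadingCoeff := by
      intro s
      rw [leadingCoeff, hGfam.natDegree_eq, hGs, coeff_map, coeff_natDegree]
    have hG1 : (shearHom ℂ[X] n N G).map (paramEval u (Ψ (u, x')).2) = Gs 1 := by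
      simp only [hGs, hu1, hξ1]
    have hmain := norm_eval_add_sub_eval_le hGfam hg (hgap.of_dvd hne hdvd)
      (L := 2 * L) (κ := 1 + L) (by linarith) (by linarith) (by
        rw [hleadG, hleadG, add_sub_cancel_left]
        refine (hτ0 (u, x') 1 _ (Finset.mem_union_right _
          (Finset.mem_image_of_mem _ hG))).trans ?_
        exact mul_le_mul_of_nonneg_right hε'L (norm_nonneg _))
      (η := fun z => η ((u, x'), z)) (hηL (u, x'))
      (fun α hα => hηα (u, x') α (hα.of_dvd hne hdvd)) z
    rw [hG1]
    refine hmain.trans (mul_le_mul_of_nonneg_right (le_trans ?_ hLε) (norm_nonneg _))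
    have hdeg : (shearHom ℂ[X] n N G).natDegree ≤ d := by
      rw [← hd]
      exact natDegree_le_of_dvd (hfac G hG) hP0
    have := pow_le_pow_right₀ (by linarith : 1 ≤ 1 + 2 * L) hdeg
    nlinarith
  exact norm_sub_le_of_common_near hε (key t) (key t')

end Step

theorem eventually_cofinite_eval_ne_zero {g : ℂ[X]} (hg : g ≠ 0) :
    ∀ᶠ c in cofinite, g.eval c ≠ 0 := by
  simpa [Filter.eventually_cofinite] using finite_setOfPred_isRoot hg

theorem eventually_forall_mem_ball {c : ℂ} {p : ℂ → Prop} (h : ∀ᶠ t in 𝓝 c, p t) :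
    ∀ᶠ r in 𝓝[>] (0 : ℝ), ∀ t ∈ Metric.ball c r, p t := by
  obtain ⟨δ, hδ, hp⟩ := Metric.eventually_nhds_iff_ball.1 h
  filter_upwards [Ioo_mem_nhdsGT hδ] with r hr t ht
  exact hp t (Metric.ball_subset_ball hr.2.le ht)

theorem eventually_norm_eval_sub_le {g : ℂ[X]} {c : ℂ} (hg : g.eval c ≠ 0) {ε : ℝ} (hε : 0 < ε) :
    ∀ᶠ r in 𝓝[>] (0 : ℝ), ∀ t ∈ Metric.ball c r, ∀ t' ∈ Metric.ball c r,
      ‖g.eval t - g.eval t'‖ ≤ ε * ‖g.eval t'‖ := by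
  set a := ‖g.eval c‖ with ha
  have ha0 : 0 < a := norm_pos_iff.2 hg
  have hδ : 0 < min (1 / 2) (ε / 4) * a := by positivity
  have hc : ∀ᶠ t in 𝓝 c, ‖g.eval t - g.eval c‖ < min (1 / 2) (ε / 4) * a := by
    simpa [dist_eq_norm] using Metric.tendsto_nhds.1 (g.continuous.tendsto c) _ hδ
  filter_upwards [eventually_forall_mem_ball hc] with r hr t ht t' ht'
  have h1 := hr t ht
  have h2 := hr t' ht'
  have h3 : ‖g.eval t - g.eval t'‖ ≤ ‖g.eval t - g.eval c‖ + ‖g.eval t' - g.eval c‖ := by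
    have := norm_sub_le (g.eval t - g.eval c) (g.eval t' - g.eval c)
    rwa [sub_sub_sub_cancel_right] at this
  have h4 : a ≤ ‖g.eval t'‖ + ‖g.eval t' - g.eval c‖ := by
    have := norm_sub_le (g.eval t') (g.eval t' - g.eval c)
    rwa [sub_sub_cancel] at this
  have h5 : min (1 / 2) (ε / 4) * a ≤ 1 / 2 * a :=
    mul_le_mul_of_nonneg_right (min_le_left _ _) ha0.le
  have h6 : min (1 / 2) (ε / 4) * a ≤ ε / 4 * a :=
    mul_le_mul_of_nonneg_right (min_le_right _ _) ha0.le
  nlinarith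

theorem HasRelTrivialization.mono {n : ℕ} {𝓕 : Finset (MvPolynomial (Fin n) ℂ[X])} {c : ℂ}
    {r ε ε' : ℝ} (h : HasRelTrivialization 𝓕 c r ε) (hε : ε ≤ ε') :
    HasRelTrivialization 𝓕 c r ε' := by
  obtain ⟨Φ, h1, h2⟩ := h
  exact ⟨Φ, h1, fun G hG t t' x =>
    (h2 G hG t t' x).trans (mul_le_mul_of_nonneg_right hε (norm_nonneg _))⟩

theorem HasRelTrivialization.of_filter_ne_zero {n : ℕ}
    {𝓕 : Finset (MvPolynomial (Fin n) ℂ[X])} {c : ℂ} {r ε : ℝ}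
    [DecidablePred (· ≠ (0 : MvPolynomial (Fin n) ℂ[X]))]
    (h : HasRelTrivialization (𝓕.filter (· ≠ 0)) c r ε) : HasRelTrivialization 𝓕 c r ε := by
  obtain ⟨Φ, h1, h2⟩ := h
  refine ⟨Φ, h1, fun G hG t t' x => ?_⟩
  by_cases hG0 : G = 0
  · simp [hG0]
  · exact h2 G (Finset.mem_filter.2 ⟨hG, hG0⟩) t t' x

theorem eventually_hasRelTrivialization_fin_zero (𝓕 : Finset (MvPolynomial (Fin 0) ℂ[X])) :
    ∀ᶠ c in cofinite, ∀ ε > 0, ∀ᶠ r in 𝓝[>] (0 : ℝ), HasRelTrivialization 𝓕 c r ε := by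
  classical
  have h : ∀ᶠ c in cofinite, ∀ G ∈ 𝓕.filter (· ≠ 0), (MvPolynomial.coeff 0 G).eval c ≠ 0 := by
    rw [Filter.eventually_all_finset]
    intro G hG
    refine eventually_cofinite_eval_ne_zero fun h0 => (Finset.mem_filter.1 hG).2 ?_
    rw [MvPolynomial.eq_C_of_isEmpty G, h0, map_zero]
  filter_upwards [h] with c hc ε hε
  have h1 : ∀ᶠ r in 𝓝[>] (0 : ℝ), ∀ G ∈ 𝓕.filter (· ≠ 0), ∀ t ∈ Metric.ball c r,
      ∀ t' ∈ Metric.ball c r, ‖(MvPolynomial.coeff 0 G).eval t -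
        (MvPolynomial.coeff 0 G).eval t'‖ ≤ ε * ‖(MvPolynomial.coeff 0 G).eval t'‖ := by
    rw [Filter.eventually_all_finset]
    exact fun G hG => eventually_norm_eval_sub_le (hc G hG) hε
  filter_upwards [h1] with r hr
  refine HasRelTrivialization.of_filter_ne_zero
    ⟨Homeomorph.refl _, fun _ => rfl, fun G hG t t' x => ?_⟩
  have hG' : ∀ (t : ℂ) (x : Fin 0 → ℂ),
      paramEval t x G = (MvPolynomial.coeff 0 G).eval t := by
    intro t x
    conv_lhs => rw [MvPolynomial.eq_C_of_isEmpty G]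
    simp [paramEval]
  rw [hG', hG']
  exact hr G hG t t.2 t' t'.2

theorem exists_step_constants (d : ℕ) {ε : ℝ} (hε : 0 < ε) :
    ∃ θ L ε' : ℝ, 0 < θ ∧ 4 * θ ≤ 1 / 2 ∧ L ≤ 1 / 4 ∧ 8 * (4 * θ) * (d * d + 1) < L ∧
      ε' < θ ^ (d * d) ∧ ε' ≤ L ∧ (1 + L) * (1 + 2 * L) ^ d - 1 ≤ ε ∧ 0 < ε' := by
  have h1 : ∀ᶠ L in 𝓝[>] (0 : ℝ), (1 + L) * (1 + 2 * L) ^ d - 1 < ε := by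
    refine nhdsWithin_le_nhds (ContinuousAt.eventually_lt (by fun_prop) continuousAt_const ?_)
    simpa using hε
  obtain ⟨L, hL, hL0, hL4⟩ := (h1.and (Ioo_mem_nhdsGT (by norm_num : (0 : ℝ) < 1 / 4))).exists
  have hd : (0 : ℝ) < d * d + 1 := by positivity
  have hθ : 0 < L / (64 * (d * d + 1)) := by positivity
  have hθe : L / (64 * (d * d + 1)) * (d * d + 1) = L / 64 := by field_simp
  refine ⟨L / (64 * (d * d + 1)), L, min L ((L / (64 * (d * d + 1))) ^ (d * d) / 2), hθ, ?_,
    hL4.le, ?_, ?_, min_le_left _ _, hL.le, ?_⟩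
  · nlinarith [mul_nonneg hθ.le (by positivity : (0 : ℝ) ≤ d * d)]
  · nlinarith
  · exact (min_le_right _ _).trans_lt (half_lt_self (by positivity))
  · positivity

/-- For all but finitely many `c`, a given finite family of polynomials is almost constant along a
suitable trivialization of affine space over a small disc around `c`. -/
theorem eventually_hasRelTrivialization {n : ℕ} (𝓕 : Finset (MvPolynomial (Fin n) ℂ[X])) :
    ∀ᶠ c in cofinite, ∀ ε > 0, ∀ᶠ r in 𝓝[>] (0 : ℝ), HasRelTrivialization 𝓕 c r ε := by
  classical
  induction n with
  | zero => exact eventually_hasRelTrivialization_fin_zero 𝓕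
  | succ n ih =>
    set 𝓖 := 𝓕.filter (· ≠ 0) with h𝓖
    set N := 2 + 𝓖.sup MvPolynomial.totalDegree with hN
    have hex : ∀ G ∈ 𝓖, ∃ l ≠ 0, (shearHom ℂ[X] n N G).leadingCoeff = MvPolynomial.C l :=
      fun G hG => exists_leadingCoeff_shearHom (Finset.mem_filter.1 hG).2 (by omega) <|
        (Finset.le_sup (f := MvPolynomial.totalDegree) hG).trans_lt (by omega)
    choose! l hl0 hl using hex
    have hlc : ∀ᶠ c in cofinite, ∀ G ∈ 𝓖, (l G).eval c ≠ 0 := by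
      rw [Filter.eventually_all_finset]
      exact fun G hG => eventually_cofinite_eval_ne_zero (hl0 G hG)
    filter_upwards [hlc, ih (controlFamily N 𝓖)] with c hc hcontrol ε hε
    have hr : ∀ᶠ r in 𝓝[>] (0 : ℝ), ∀ t ∈ Metric.ball c r, ∀ G ∈ 𝓖, (l G).eval t ≠ 0 := by
      refine eventually_forall_mem_ball ((Filter.eventually_all_finset _).2 fun G hG => ?_)
      exact (l G).continuous.continuousAt.eventually_ne (hc G hG)
    obtain ⟨θ, L, ε', hθ, hθ1, hL, hθL, hε'θ, hε'L, hLε, hε'⟩ :=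
      exists_step_constants (shearProd N 𝓖).natDegree (by positivity : 0 < min (ε / 4) (1 / 2))
    filter_upwards [hr, hcontrol ε' hε'] with r hr hctl
    refine ((HasRelTrivialization.succ hl hr rfl hθ hθ1 hL hθL hε'θ hε'L (min_le_right _ _) hLε
      hctl).mono ?_).of_filter_ne_zero
    linarith [min_le_left (ε / 4) (1 / 2)]

/-- A polynomial minus the parameter. -/
def subParam {n : ℕ} (f : MvPolynomial (Fin n) ℂ) : MvPolynomial (Fin n) ℂ[X] :=
  MvPolynomial.map Polynomial.C f - MvPolynomial.C Polynomial.X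

theorem paramEval_subParam {n : ℕ} (f : MvPolynomial (Fin n) ℂ) (t : ℂ) (x : Fin n → ℂ) :
    paramEval t x (subParam f) = MvPolynomial.eval x f - t := by
  have h : (evalRingHom t).comp Polynomial.C = RingHom.id ℂ := by ext a; simp
  simp only [subParam, paramEval, map_sub, MvPolynomial.coe_eval₂Hom, MvPolynomial.eval₂_map, h,
    MvPolynomial.eval₂_C, coe_evalRingHom, eval_X]
  rfl

/-- A relative trivialization moves the fibers of a polynomial to one another. -/
theorem HasRelTrivialization.exists_transport {n : ℕ} {f : MvPolynomial (Fin n) ℂ} {c : ℂ}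
    {r ε : ℝ} (h : HasRelTrivialization {subParam f} c r ε) :
    ∃ T : Metric.ball c r × Metric.ball c r × (Fin n → ℂ) → Fin n → ℂ, Continuous T ∧
      (∀ t u x, T (u, t, T (t, u, x)) = x) ∧
      ∀ (t u : Metric.ball c r) x, MvPolynomial.eval x f = t →
        MvPolynomial.eval (T (t, u, x)) f = u := by
  obtain ⟨Φ, hΦ1, hΦ⟩ := h
  have hsymm : ∀ q, (Φ.symm q).1 = q.1 := fun q => by
    rw [← hΦ1 (Φ.symm q), Φ.apply_symm_apply]
  have hpair : ∀ t x, (t, (Φ.symm (t, x)).2) = Φ.symm (t, x) := fun t x =>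
    Prod.ext (hsymm (t, x)).symm rfl
  have hpair' : ∀ t x, (t, (Φ (t, x)).2) = Φ (t, x) := fun t x => Prod.ext (hΦ1 (t, x)).symm rfl
  refine ⟨fun q => (Φ (q.2.1, (Φ.symm (q.1, q.2.2)).2)).2, by fun_prop, fun t u x => ?_,
    fun t u x hx => ?_⟩
  · simp only [hpair', Φ.symm_apply_apply, hpair, Φ.apply_symm_apply]
  · have h1 := hΦ _ (Finset.mem_singleton_self _) u t (Φ.symm (t, x)).2
    rw [hpair, Φ.apply_symm_apply, paramEval_subParam, paramEval_subParam, hx, sub_self, norm_zero,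
      mul_zero, sub_zero] at h1
    exact sub_eq_zero.1 (norm_le_zero_iff.1 h1)

/-- fibration theorem / Sard's theorem for polynomials.  For every
polynomial map `f : ℂⁿ → ℂ` there is a finite set `Σ ⊂ ℂ` such that the restriction
`f : ℂⁿ \ f⁻¹(Σ) → ℂ \ Σ` is a locally trivial fibration. -/
theorem statement11 (n : ℕ) (hn : 1 ≤ n) (f : MvPolynomial (Fin n) ℂ) :
    ∃ Sig : Set ℂ, Sig.Finite ∧
      LocTrivFibration (fun x : {x : Fin n → ℂ // MvPolynomial.eval x f ∉ Sig} =>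
        (⟨MvPolynomial.eval x.1 f, x.2⟩ : {t : ℂ // t ∉ Sig})) := by
  obtain ⟨S, hS, hc⟩ : ∃ S : Set ℂ, S.Finite ∧ ∀ c ∉ S, ∃ r > 0,
      HasRelTrivialization {subParam f} c r 1 := by
    refine ⟨_, eventually_cofinite.1 (eventually_hasRelTrivialization {subParam f}), fun c hc => ?_⟩
    obtain ⟨r, hr, hr0⟩ := ((not_not.1 hc 1 one_pos).and self_mem_nhdsWithin).exists
    exact ⟨r, hr0, hr⟩
  refine ⟨S, hS, fun ⟨c, hcS⟩ => ?_⟩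
  obtain ⟨r, hr0, hr⟩ := hc c hcS
  obtain ⟨T, hT, hTT, hTf⟩ := hr.exists_transport
  have hf : Continuous fun x => MvPolynomial.eval x f := MvPolynomial.continuous_eval f
  have hcr : c ∈ Metric.ball c r := Metric.mem_ball_self hr0
  refine ⟨{t | (t : ℂ) ∈ Metric.ball c r}, Metric.isOpen_ball.preimage continuous_subtype_val, hcr,
    ⟨⟨fun x => (⟨⟨MvPolynomial.eval x.1.1 f, x.1.2⟩, x.2⟩,
        ⟨⟨T (⟨_, x.2⟩, ⟨c, hcr⟩, x.1.1), ?_⟩, ?_⟩),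
      fun q => ⟨⟨T (⟨c, hcr⟩, ⟨q.1.1.1, q.1.2⟩, q.2.1.1), ?_⟩, ?_⟩, fun x => ?_, fun q => ?_⟩,
      ?_, ?_⟩, fun x => rfl⟩
  · rw [hTf _ ⟨c, hcr⟩ _ rfl]
    exact hcS
  · exact Subtype.ext (hTf _ ⟨c, hcr⟩ _ rfl)
  · rw [hTf _ _ _ (congrArg Subtype.val q.2.2)]
    exact q.1.1.2
  · change MvPolynomial.eval (T _) f ∈ Metric.ball c r
    rw [hTf _ _ _ (congrArg Subtype.val q.2.2)]
    exact q.1.2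
  · exact Subtype.ext (Subtype.ext (hTT _ _ _))
  · have h : MvPolynomial.eval (T (⟨c, hcr⟩, ⟨q.1.1.1, q.1.2⟩, q.2.1.1)) f = q.1.1.1 :=
      hTf _ _ _ (congrArg Subtype.val q.2.2)
    refine Prod.ext (Subtype.ext (Subtype.ext h)) (Subtype.ext (Subtype.ext ?_))
    simp only [h]
    exact hTT _ _ _
  · refine Continuous.prodMk ?_ ?_
    · exact Continuous.subtype_mk (Continuous.subtype_mk (by fun_prop) _) _
    · refine Continuous.subtype_mk (Continuous.subtype_mk (hT.comp ?_) _) _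
      exact Continuous.prodMk (Continuous.subtype_mk (by fun_prop) _) (by fun_prop)
  · refine Continuous.subtype_mk (Continuous.subtype_mk (hT.comp ?_) _) _
    exact continuous_const.prodMk ((Continuous.subtype_mk (by fun_prop) _).prodMk (by fun_prop))

end
end

section
/- (Broughton's theorem on tame polynomials.) Let n ≥ 1 and let f : ℂⁿ → ℂ be a polynomial map. Suppose f is tame: there exists δ > 0 such that the set {x ∈ ℂⁿ : ‖grad f(x)‖ ≤ δ} is compact. Let K = f({x ∈ ℂⁿ : grad f(x) = 0}) be the set of critical values of f. Then the restriction f : ℂⁿ \ f⁻¹(K) → ℂ \ K is a locally trivial fibration: every c ∈ ℂ \ K has an open neighborhood U ⊆ ℂ \ K and a homeomorphism h : f⁻¹(U) → U × f⁻¹(c) whose composition with the projection to U equals f. (In other words, a tame polynomial has no critical values coming from infinity.) -/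
open MvPolynomial Filter

noncomputable section

/-- The set of critical values of a polynomial map `f : ℂⁿ → ℂ`: the image of the set of
points where all partial derivatives (equivalently, `grad f`) vanish. -/
def critValues (n : ℕ) (f : MvPolynomial (Fin n) ℂ) : Set ℂ :=
  (fun x => MvPolynomial.eval x f) ''
    {x : Fin n → ℂ | ∀ i, MvPolynomial.eval x (MvPolynomial.pderiv i f) = 0}

section Broughton

open Set Metric Topology
open scoped NNReal

section Flow

variable {E : Type*} [NormedAddCommGroup E] [NormedSpace ℝ E] {V : E → E}

/-- Integral curves of a locally Lipschitz vector field are determined by their value at `0`. -/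
lemma LocallyLipschitz.integralCurve_unique (hV : LocallyLipschitz V) {γ₁ γ₂ : ℝ → E} {T : ℝ}
    (h₁ : ∀ t ∈ Ioo (-T) T, HasDerivAt γ₁ (V (γ₁ t)) t)
    (h₂ : ∀ t ∈ Ioo (-T) T, HasDerivAt γ₂ (V (γ₂ t)) t) (h₀ : γ₁ 0 = γ₂ 0) :
    EqOn γ₁ γ₂ (Ioo (-T) T) := by
  intro t ht
  have htT : |t| < T := abs_lt.2 ht
  obtain ⟨T', htT', hT'T⟩ := exists_between htT
  have hT' : 0 < T' := (abs_nonneg t).trans_lt htT'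
  have hsub : Icc (-T') T' ⊆ Ioo (-T) T := Icc_subset_Ioo (by linarith) hT'T
  have c₁ : ContinuousOn γ₁ (Icc (-T') T') := HasDerivAt.continuousOn fun s hs => h₁ s (hsub hs)
  have c₂ : ContinuousOn γ₂ (Icc (-T') T') := HasDerivAt.continuousOn fun s hs => h₂ s (hsub hs)
  obtain ⟨K, hK⟩ := (hV.locallyLipschitzOn (s := γ₁ '' Icc (-T') T' ∪ γ₂ '' Icc (-T') T')
    ).exists_lipschitzOnWith_of_compact
      ((isCompact_Icc.image_of_continuousOn c₁).union (isCompact_Icc.image_of_continuousOn c₂))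
  refine ODE_solution_unique_of_mem_Icc (v := fun _ => V) (t₀ := 0) (fun _ _ => hK)
    ⟨by linarith, hT'⟩ c₁ (fun s hs => h₁ s (hsub (Ioo_subset_Icc_self hs)))
    (fun s hs => Or.inl (mem_image_of_mem _ (Ioo_subset_Icc_self hs))) c₂
    (fun s hs => h₂ s (hsub (Ioo_subset_Icc_self hs)))
    (fun s hs => Or.inr (mem_image_of_mem _ (Ioo_subset_Icc_self hs))) h₀ ?_
  exact abs_le.1 htT'.le

/-- A bounded locally Lipschitz vector field has, for every `T`, a local flow defined up to
time `T` near every point. -/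
lemma LocallyLipschitz.exists_localFlow_of_bounded [ProperSpace E] (hV : LocallyLipschitz V)
    {M : ℝ≥0} (hM : ∀ x, ‖V x‖ ≤ M) (x₀ : E) {T : ℝ} (hT : 0 < T) :
    ∃ α : E × ℝ → E, (∀ x ∈ closedBall x₀ 1, α (x, 0) = x ∧
      ∀ t ∈ Ioo (-T) T, HasDerivAt (fun s => α (x, s)) (V (α (x, t))) t) ∧
      ContinuousOn α (closedBall x₀ 1 ×ˢ Icc (-T) T) := by
  lift T to ℝ≥0 using hT.le
  obtain ⟨K, hK⟩ := (hV.locallyLipschitzOn (s := closedBall x₀ (M * T + 1 : ℝ≥0))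
    ).exists_lipschitzOnWith_of_compact (isCompact_closedBall _ _)
  have hPL : IsPicardLindelof (fun _ => V) (tmin := -T) (tmax := T)
      ⟨0, by simp⟩ x₀ (M * T + 1) 1 M K :=
    { lipschitzOnWith := fun _ _ => hK
      continuousOn := fun _ _ => continuousOn_const
      norm_le := fun _ _ x _ => hM x
      mul_max_le := by simp }
  obtain ⟨α, hα, hc⟩ := hPL.exists_forall_mem_closedBall_eq_hasDerivWithinAt_continuousOn
  exact ⟨α, fun x hx => ⟨(hα x hx).1, fun t ht => ((hα x hx).2 t (Ioo_subset_Icc_self ht)).hasDerivAt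
    (Icc_mem_nhds ht.1 ht.2)⟩, hc⟩

/-- A bounded locally Lipschitz vector field generates a global flow. -/
theorem LocallyLipschitz.exists_flow_of_bounded [ProperSpace E] (hV : LocallyLipschitz V)
    {M : ℝ≥0} (hM : ∀ x, ‖V x‖ ≤ M) :
    ∃ Φ : Flow ℝ E, ∀ x t, HasDerivAt (fun s => Φ s x) (V (Φ t x)) t := by
  have hex : ∀ (x : E) (T : ℝ), ∃ γ : ℝ → E, 0 < T → γ 0 = x ∧
      ∀ t ∈ Ioo (-T) T, HasDerivAt γ (V (γ t)) t := by
    intro x T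
    by_cases hT : 0 < T
    · obtain ⟨α, hα, -⟩ := hV.exists_localFlow_of_bounded hM x hT
      exact ⟨fun s => α (x, s), fun _ => hα x (mem_closedBall_self zero_le_one)⟩
    · exact ⟨0, fun h => absurd h hT⟩
  choose γ hγ using hex
  have hpos : ∀ t : ℝ, 0 < |t| + 1 := fun t => by positivity
  have hmem : ∀ t : ℝ, t ∈ Ioo (-(|t| + 1)) (|t| + 1) := fun t => abs_lt.1 (lt_add_one _)
  let φ : ℝ → E → E := fun t x => γ x (|t| + 1) t
  have hφ0 : ∀ x, φ 0 x = x := fun x => (hγ x _ (hpos 0)).1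
  have hφ : ∀ {T : ℝ} {x : E} {β : ℝ → E}, β 0 = x →
      (∀ t ∈ Ioo (-T) T, HasDerivAt β (V (β t)) t) → ∀ t ∈ Ioo (-T) T, φ t x = β t := by
    intro T x β h0 hβ t ht
    have hT : |t| < T := abs_lt.2 ht
    rcases le_total T (|t| + 1) with h | h
    · refine hV.integralCurve_unique (T := T) (fun s hs => (hγ x _ (hpos t)).2 s ?_) hβ
        ((hγ x _ (hpos t)).1.trans h0.symm) ht
      exact ⟨by linarith [hs.1], by linarith [hs.2]⟩
    · refine hV.integralCurve_unique (T := |t| + 1) (hγ x _ (hpos t)).2 (fun s hs => hβ s ?_)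
        ((hγ x _ (hpos t)).1.trans h0.symm) (hmem t)
      exact ⟨by linarith [hs.1], by linarith [hs.2]⟩
  have hφd : ∀ x t, HasDerivAt (fun s => φ s x) (V (φ t x)) t := by
    intro x t
    have hx := hγ x _ (hpos t)
    refine (hx.2 t (hmem t)).congr_of_eventuallyEq ?_
    filter_upwards [Ioo_mem_nhds (hmem t).1 (hmem t).2] with s hs
    exact hφ hx.1 hx.2 s hs
  have hcont : Continuous (Function.uncurry φ) := by
    refine continuous_iff_continuousAt.2 fun ⟨t, x⟩ => ?_
    obtain ⟨α, hα, hc⟩ := hV.exists_localFlow_of_bounded hM x (hpos t)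
    have hnhds : Ioo (-(|t| + 1)) (|t| + 1) ×ˢ closedBall x 1 ∈ 𝓝 (t, x) :=
      prod_mem_nhds (Ioo_mem_nhds (hmem t).1 (hmem t).2) (closedBall_mem_nhds x one_pos)
    have hα' : ContinuousAt (fun p : ℝ × E => α (p.2, p.1)) (t, x) := by
      refine ContinuousAt.comp' (g := α) (hc.continuousAt ?_) (by fun_prop)
      exact prod_mem_nhds (closedBall_mem_nhds x one_pos) (Icc_mem_nhds (hmem t).1 (hmem t).2)
    refine hα'.congr ?_
    filter_upwards [hnhds] with p hp
    exact (hφ (hα _ hp.2).1 (hα _ hp.2).2 _ hp.1).symm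
  refine ⟨⟨φ, hcont, fun s t x => ?_, hφ0⟩, hφd⟩
  have hadd : φ s (φ t x) = φ (s + t) x :=
    hφ (β := fun r => φ (r + t) x) (by simp)
      (fun r _ => (hφd x (r + t)).comp_add_const r t) s (hmem s)
  exact hadd.symm

end Flow

/-- If the velocity of `g` is `a t * e` with `0 ≤ a ≤ 1`, and `a = 1` as long as `g` stays in a
convex set containing `g 0` and `g 0 + T * e`, then `g T = g 0 + T * e`. -/
lemma eq_add_mul_of_hasDerivAt_of_convex {g : ℝ → ℂ} {a : ℝ → ℝ} {e : ℂ} {B : Set ℂ} {T : ℝ}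
    (ha : Continuous a) (hg : ∀ t, HasDerivAt g (a t * e) t) (ha0 : ∀ t, 0 ≤ a t)
    (ha1 : ∀ t, a t ≤ 1) (hB : Convex ℝ B) (haB : ∀ t, g t ∈ B → a t = 1)
    (h0 : g 0 ∈ B) (hT : g 0 + T * e ∈ B) : g T = g 0 + T * e := by
  let A : ℝ → ℝ := fun t => ∫ s in (0 : ℝ)..t, a s
  have hA : ∀ t, HasDerivAt A (a t) t := fun t => ha.integral_hasStrictDerivAt 0 t |>.hasDerivAt
  have hA0 : A 0 = 0 := intervalIntegral.integral_same
  have hmono : Monotone A := monotone_of_hasDerivAt_nonneg hA ha0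
  have hmono' : Monotone fun t => t - A t :=
    monotone_of_hasDerivAt_nonneg (fun t => (hasDerivAt_id t).sub (hA t))
      fun t => sub_nonneg.2 (ha1 t)
  have hgA : ∀ t, g t = g 0 + A t * e := by
    have hd : ∀ t, HasDerivAt (fun t => g t - A t * e) 0 t := fun t => by
      simpa using (hg t).fun_sub ((hA t).ofReal_comp.mul_const e)
    intro t
    have := is_const_of_deriv_eq_zero (fun t => (hd t).differentiableAt) (fun t => (hd t).deriv) t 0
    simp only [hA0, Complex.ofReal_zero, zero_mul, sub_zero] at this
    rw [← this]; ring
  have hAmem : ∀ t ∈ uIcc 0 T, A t ∈ uIcc 0 T := by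
    intro t ht
    rw [mem_uIcc] at ht ⊢
    rcases ht with ht | ht
    · have h1 := hmono ht.1
      have h2 := hmono' ht.1
      simp only [hA0] at h1 h2
      exact Or.inl ⟨h1, by linarith [ht.2]⟩
    · have h1 := hmono ht.2
      have h2 := hmono' ht.2
      simp only [hA0] at h1 h2
      exact Or.inr ⟨by linarith [ht.1], h1⟩
  have hline : Convex ℝ {s : ℝ | g 0 + s * e ∈ B} := by
    intro s hs t ht p q hp hq hpq
    have := hB hs ht hp hq hpq
    simp only [mem_ofPred_eq] at this ⊢
    convert this using 1
    have hpq' : (p : ℂ) + q = 1 := by exact_mod_cast hpq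
    simp only [Complex.real_smul, smul_eq_mul, Complex.ofReal_add, Complex.ofReal_mul]
    linear_combination (-g 0) * hpq'
  have hsub : uIcc 0 T ⊆ {s : ℝ | g 0 + s * e ∈ B} :=
    hline.ordConnected.uIcc_subset (by simpa using h0) hT
  have hAT : A T = T := by
    have : A T = ∫ _ in (0 : ℝ)..T, (1 : ℝ) := intervalIntegral.integral_congr fun t ht =>
      haB t (by rw [hgA t]; exact hsub (hAmem t ht))
    simpa using this
  rw [hgA T, hAT]

lemma MvPolynomial.hasDerivAt_eval_comp {σ : Type*} [Fintype σ] (f : MvPolynomial σ ℂ)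
    {γ : ℝ → σ → ℂ} {v : σ → ℂ} {t : ℝ} (hγ : HasDerivAt γ v t) :
    HasDerivAt (fun s => eval (γ s) f) (∑ i, eval (γ t) (pderiv i f) * v i) t := by
  classical
  induction f using MvPolynomial.induction_on with
  | C a => simpa using hasDerivAt_const t a
  | add p q hp hq => simpa [add_mul, Finset.sum_add_distrib] using hp.fun_add hq
  | mul_X p j hp =>
    have h := hp.mul (hasDerivAt_pi.1 hγ j)
    simp only [map_mul, eval_X]
    refine h.congr_deriv ?_
    simp only [Derivation.leibniz, pderiv_X, smul_eq_mul, map_add, map_mul, eval_X, add_mul,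
      Finset.sum_add_distrib, Finset.sum_mul, Pi.single_apply, apply_ite (eval (γ t)), map_zero,
      mul_ite, ite_mul, mul_one, mul_zero, zero_mul]
    simp
    rw [add_comm]
    congr 1
    exact Finset.sum_congr rfl fun i _ => by ring
/-- A map to the plane is a locally trivial fibration off `K` if near every point off `K` there
are flows lifting the horizontal and the vertical translations. -/
lemma locTrivFibration_of_flows {E : Type*} [TopologicalSpace E] {f : E → ℂ} (hf : Continuous f)
    {K : Set ℂ}
    (h : ∀ c ∉ K, ∃ r > (0 : ℝ), ball c r ⊆ Kᶜ ∧ ∃ Φ Ψ : Flow ℝ E,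
      (∀ x (t : ℝ), f x ∈ ball c r → f x + t * 1 ∈ ball c r → f (Φ t x) = f x + t * 1) ∧
      ∀ x (t : ℝ), f x ∈ ball c r → f x + t * Complex.I ∈ ball c r →
        f (Ψ t x) = f x + t * Complex.I) :
    LocTrivFibration (fun x : {x : E // f x ∉ K} => (⟨f x.1, x.2⟩ : {t : ℂ // t ∉ K})) := by
  rintro ⟨c, hc⟩
  obtain ⟨r, hr, hrK, Φ, Ψ, hΦ, hΨ⟩ := h c hc
  have hre : ∀ {w : ℂ}, w ∈ ball c r → c + (w - c).re ∈ ball c r := fun {w} hw => by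
    rw [mem_ball_iff_norm] at hw ⊢
    rw [add_sub_cancel_left, Complex.norm_real, Real.norm_eq_abs]
    exact (Complex.abs_re_le_norm _).trans_lt hw
  have hdec : ∀ w : ℂ, c + ((w - c).re : ℂ) + ((w - c).im : ℂ) * Complex.I = w := fun w => by
    rw [add_assoc, Complex.re_add_im, add_sub_cancel]
  let fwd : ℂ → E → E := fun w x => Ψ (w - c).im (Φ (w - c).re x)
  let bwd : ℂ → E → E := fun w x => Φ (-(w - c).re) (Ψ (-(w - c).im) x)
  have hbf : ∀ w x, bwd w (fwd w x) = x := fun w x => by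
    simp only [fwd, bwd, ← Flow.map_add, neg_add_cancel, Flow.map_zero_apply]
  have hfb : ∀ w x, fwd w (bwd w x) = x := fun w x => by
    simp only [fwd, bwd, ← Flow.map_add, add_neg_cancel, Flow.map_zero_apply]
  have hffwd : ∀ {w x}, w ∈ ball c r → f x = c → f (fwd w x) = w := fun {w x} hw hx => by
    have h1 : f (Φ (w - c).re x) = c + (w - c).re := by
      rw [hΦ x (w - c).re (by simpa [hx] using hr) (by simpa [hx] using hre hw), hx, mul_one]
    rw [hΨ _ _ (by rw [h1]; exact hre hw) (by rw [h1, hdec]; exact hw), h1, hdec]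
  have hfbwd : ∀ {x}, f x ∈ ball c r → f (bwd (f x) x) = c := fun {x} hx => by
    have e1 : f x + ((-(f x - c).im : ℝ) : ℂ) * Complex.I = c + (f x - c).re := by
      conv_lhs => enter [1]; rw [← hdec (f x)]
      push_cast; ring
    have h1 : f (Ψ (-(f x - c).im) x) = c + (f x - c).re := by
      rw [hΨ _ _ hx (by rw [e1]; exact hre hx), e1]
    have e2 : c + ((f x - c).re : ℂ) + ((-(f x - c).re : ℝ) : ℂ) * 1 = c := by
      push_cast; ring
    rw [hΦ _ _ (by rw [h1]; exact hre hx) (by rw [h1, e2]; exact mem_ball_self hr), h1, e2]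
  have cfwd : Continuous (Function.uncurry fwd) := by
    simp only [fwd, Function.uncurry_def]
    exact Ψ.continuous (by fun_prop) (Φ.continuous (by fun_prop) (by fun_prop))
  have cbwd : Continuous (Function.uncurry bwd) := by
    simp only [bwd, Function.uncurry_def]
    exact Φ.continuous (by fun_prop) (Ψ.continuous (by fun_prop) (by fun_prop))
  refine ⟨Subtype.val ⁻¹' ball c r, isOpen_ball.preimage continuous_subtype_val,
    mem_ball_self hr, ?_, ?_⟩
  · exact
    { toFun := fun x => ⟨⟨⟨f x.1.1, x.1.2⟩, x.2⟩,
        ⟨⟨bwd (f x.1.1) x.1.1, by rw [hfbwd x.2]; exact hc⟩, Subtype.ext (hfbwd x.2)⟩⟩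
      invFun := fun p => ⟨⟨fwd p.1.1.1 p.2.1.1, by
          rw [hffwd p.1.2 (Subtype.ext_iff.1 p.2.2)]; exact p.1.1.2⟩, by
          change f (fwd p.1.1.1 p.2.1.1) ∈ ball c r
          rw [hffwd p.1.2 (Subtype.ext_iff.1 p.2.2)]; exact p.1.2⟩
      left_inv := fun x => Subtype.ext (Subtype.ext (hfb _ _))
      right_inv := fun p => by
        have hp := hffwd p.1.2 (Subtype.ext_iff.1 p.2.2)
        refine Prod.ext (Subtype.ext (Subtype.ext hp)) (Subtype.ext (Subtype.ext ?_))
        simp only [hp, hbf]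
      continuous_toFun := by
        have hv : Continuous fun x : ((fun x : {x : E // f x ∉ K} =>
            (⟨f x.1, x.2⟩ : {t : ℂ // t ∉ K})) ⁻¹' (Subtype.val ⁻¹' ball c r)) => x.1.1 :=
          continuous_subtype_val.comp continuous_subtype_val
        exact (((hf.comp hv).subtype_mk _).subtype_mk _).prodMk
          (((cbwd.comp ((hf.comp hv).prodMk hv)).subtype_mk _).subtype_mk _)
      continuous_invFun := by
        refine Continuous.subtype_mk (Continuous.subtype_mk (cfwd.comp (Continuous.prodMk ?_ ?_)) _) _
        · fun_prop
        · fun_prop }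
  · exact fun x => rfl

lemma LocallyLipschitz.smul {X F : Type*} [PseudoEMetricSpace X] [NormedAddCommGroup F]
    [NormedSpace ℝ F] {c : X → ℝ} {G : X → F} (hc : LocallyLipschitz c) (hG : LocallyLipschitz G) :
    LocallyLipschitz fun x => c x • G x := by
  have hsmul : ContDiff ℝ 1 fun p : ℝ × F => p.1 • p.2 := contDiff_fst.smul contDiff_snd
  exact hsmul.locallyLipschitz.comp (hc.prodMk hG)

namespace MvPolynomial

variable {n : ℕ} (f : MvPolynomial (Fin n) ℂ)

lemma contDiff_real_eval (p : MvPolynomial (Fin n) ℂ) :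
    ContDiff ℝ 1 (fun x : Fin n → ℂ => eval x p) := by
  have h : ContDiff ℂ 1 (fun x : Fin n → ℂ => eval x p) :=
    contDiffOn_univ.1 (AnalyticOnNhd.eval_mvPolynomial p).contDiffOn_of_completeSpace
  exact h.restrict_scalars ℝ

/-- The squared Euclidean norm of the gradient. -/
def gradNormSq (x : Fin n → ℂ) : ℝ := ∑ i, ‖eval x (pderiv i f)‖ ^ 2

lemma contDiff_gradNormSq : ContDiff ℝ 1 (gradNormSq f) :=
  ContDiff.sum fun i _ => (contDiff_real_eval (pderiv i f)).norm_sq ℝ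

lemma sq_norm_pderiv_le_gradNormSq (x : Fin n → ℂ) (i : Fin n) :
    ‖eval x (pderiv i f)‖ ^ 2 ≤ gradNormSq f x :=
  Finset.single_le_sum (f := fun i => ‖eval x (pderiv i f)‖ ^ 2)
    (fun _ _ => sq_nonneg _) (Finset.mem_univ i)

lemma gradNormSq_nonneg (x : Fin n → ℂ) : 0 ≤ gradNormSq f x :=
  Finset.sum_nonneg fun _ _ => sq_nonneg _

/-- The field `e • grad f / ‖grad f‖²`, truncated where `‖grad f‖² < ε`. -/
def liftField (ε : ℝ) (e : ℂ) (x : Fin n → ℂ) : Fin n → ℂ :=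
  (max (gradNormSq f x) ε)⁻¹ • fun i => e * (starRingEnd ℂ) (eval x (pderiv i f))

variable {ε : ℝ}

lemma norm_liftField_le (hε : 0 < ε) {e : ℂ} (he : ‖e‖ = 1) (x : Fin n → ℂ) :
    ‖liftField f ε e x‖ ≤ ε⁻¹ + 1 := by
  refine (pi_norm_le_iff_of_nonneg (by positivity)).2 fun i => ?_
  have hm : 0 < max (gradNormSq f x) ε := lt_max_of_lt_right hε
  have h1 := sq_norm_pderiv_le_gradNormSq f x i
  have h2 : 1 ≤ ε⁻¹ * max (gradNormSq f x) ε := by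
    rw [← inv_mul_cancel₀ hε.ne']; gcongr; exact le_max_right _ _
  have h3 := le_max_left (gradNormSq f x) ε
  simp only [liftField, Pi.smul_apply, norm_smul, norm_mul, he, one_mul, RCLike.norm_conj, norm_inv,
    Real.norm_of_nonneg hm.le]
  rw [inv_mul_le_iff₀ hm]
  nlinarith [sq_nonneg (‖eval x (pderiv i f)‖ - 1)]

lemma locallyLipschitz_liftField (hε : 0 < ε) (e : ℂ) : LocallyLipschitz (liftField f ε e) := by
  have hinv : LipschitzWith (Real.toNNReal (ε⁻¹ * ε⁻¹)) fun r : ℝ => (max r ε)⁻¹ := by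
    refine LipschitzWith.of_dist_le_mul fun a b => ?_
    have ha : 0 < max a ε := lt_max_of_lt_right hε
    have hb : 0 < max b ε := lt_max_of_lt_right hε
    rw [Real.coe_toNNReal _ (by positivity), dist_inv_inv₀ ha.ne' hb.ne', div_eq_inv_mul, mul_inv]
    rw [Real.norm_of_nonneg ha.le, Real.norm_of_nonneg hb.le]
    gcongr
    · exact le_max_right _ _
    · exact le_max_right _ _
    · simpa [Real.dist_eq] using abs_max_sub_max_le_max a ε b ε
  have hconj : ContDiff ℝ 1 (starRingEnd ℂ) := Complex.conjCLE.contDiff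
  have hG : ContDiff ℝ 1 fun (x : Fin n → ℂ) i => e * (starRingEnd ℂ) (eval x (pderiv i f)) :=
    contDiff_pi.2 fun i => contDiff_const.mul (hconj.comp (contDiff_real_eval (pderiv i f)))
  exact (hinv.locallyLipschitz.comp (contDiff_gradNormSq f).locallyLipschitz).smul
    hG.locallyLipschitz

lemma sum_pderiv_mul_liftField (e : ℂ) (x : Fin n → ℂ) :
    ∑ i, eval x (pderiv i f) * liftField f ε e x i =
      ((gradNormSq f x / max (gradNormSq f x) ε : ℝ) : ℂ) * e := by
  simp only [liftField, Pi.smul_apply, Complex.real_smul]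
  rw [div_eq_mul_inv, Complex.ofReal_mul]
  nth_rw 2 [gradNormSq]
  push_cast
  rw [Finset.sum_mul, Finset.sum_mul]
  refine Finset.sum_congr rfl fun i _ => ?_
  rw [← Complex.mul_conj']
  ring

/-- If `‖grad f‖² ≥ ε` over a convex set `B`, translations in `B` lift to a flow. -/
lemma exists_flow_lifting_translation (hε : 0 < ε) {B : Set ℂ} (hB : Convex ℝ B)
    (hf : ∀ x, eval x f ∈ B → ε ≤ gradNormSq f x) {e : ℂ} (he : ‖e‖ = 1) :
    ∃ Φ : Flow ℝ (Fin n → ℂ), ∀ x (t : ℝ), eval x f ∈ B → eval x f + t * e ∈ B →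
      eval (Φ t x) f = eval x f + t * e := by
  obtain ⟨Φ, hΦ⟩ := (locallyLipschitz_liftField f hε e).exists_flow_of_bounded
    (M := ⟨ε⁻¹ + 1, by positivity⟩) (norm_liftField_le f hε he)
  refine ⟨Φ, fun x t h0 ht => ?_⟩
  have hpos : ∀ y, 0 < max (gradNormSq f y) ε := fun y => lt_max_of_lt_right hε
  have hS := (contDiff_gradNormSq f).continuous
  have key := eq_add_mul_of_hasDerivAt_of_convex (g := fun s => eval (Φ s x) f) (T := t) (e := e)
    (a := fun s => gradNormSq f (Φ s x) / max (gradNormSq f (Φ s x)) ε)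
    (B := B) ?_ (fun s => ?_) (fun s => div_nonneg (gradNormSq_nonneg f _) (hpos _).le)
    (fun s => div_le_one_of_le₀ (le_max_left _ _) (hpos _).le) hB (fun s hs => ?_)
    (by simpa using h0) (by simpa using ht)
  · simpa using key
  · have hc : Continuous fun s => gradNormSq f (Φ s x) :=
      hS.comp (Φ.continuous continuous_id continuous_const)
    exact hc.div₀ (hc.max continuous_const) fun s => (hpos _).ne'
  · exact (hasDerivAt_eval_comp f (hΦ x s)).congr_deriv (sum_pderiv_mul_liftField f e _)
  · have h := hf _ hs
    simp only [max_eq_left h]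
    exact div_self (hε.trans_le h).ne'

end MvPolynomial

section Tame

variable {n : ℕ} {f : MvPolynomial (Fin n) ℂ} {δ : ℝ}

lemma isClosed_critValues_of_tame (hδ : 0 < δ) (hc : IsCompact {x : Fin n → ℂ |
    ‖(fun i => eval x (pderiv i f) : Fin n → ℂ)‖ ≤ δ}) : IsClosed (critValues n f) := by
  have hcont : ∀ p : MvPolynomial (Fin n) ℂ, Continuous fun x : Fin n → ℂ => eval x p :=
    fun p => (contDiff_real_eval p).continuous
  refine IsCompact.isClosed (IsCompact.image (hc.of_isClosed_subset ?_ fun x hx => ?_) (hcont f))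
  · simp only [ofPred_forall]
    exact isClosed_iInter fun i => isClosed_eq (hcont _) continuous_const
  · exact (pi_norm_le_iff_of_nonneg hδ.le).2 fun i => by simpa [hx i] using hδ.le

/-- Over a closed set of regular values, the gradient of a tame polynomial is bounded below. -/
lemma exists_le_gradNormSq_of_tame (hδ : 0 < δ) (hc : IsCompact {x : Fin n → ℂ |
    ‖(fun i => eval x (pderiv i f) : Fin n → ℂ)‖ ≤ δ}) {B : Set ℂ} (hB : IsClosed B)
    (hBK : B ⊆ (critValues n f)ᶜ) :
    ∃ ε > 0, ∀ x, eval x f ∈ B → ε ≤ gradNormSq f x := by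
  have hf : Continuous fun x : Fin n → ℂ => eval x f := (contDiff_real_eval f).continuous
  obtain ⟨m, hm, hle⟩ := (hc.inter_right (hB.preimage hf)).exists_forall_le' (a := 0)
    (contDiff_gradNormSq f).continuous.continuousOn fun x hx => by
      refine (gradNormSq_nonneg f x).lt_of_ne' fun h0 => hBK hx.2 ⟨x, fun i => ?_, rfl⟩
      have := sq_norm_pderiv_le_gradNormSq f x i
      rw [h0] at this
      exact norm_eq_zero.1 (pow_eq_zero_iff two_ne_zero |>.1 (this.antisymm (sq_nonneg _)))
  refine ⟨min m (δ ^ 2), lt_min hm (by positivity), fun x hx => ?_⟩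
  by_cases hxδ : ‖(fun i => eval x (pderiv i f) : Fin n → ℂ)‖ ≤ δ
  · exact (min_le_left _ _).trans (hle x ⟨hxδ, hx⟩)
  · rw [pi_norm_le_iff_of_nonneg hδ.le] at hxδ
    push Not at hxδ
    obtain ⟨i, hi⟩ := hxδ
    calc min m (δ ^ 2) ≤ δ ^ 2 := min_le_right _ _
      _ ≤ ‖eval x (pderiv i f)‖ ^ 2 := by gcongr
      _ ≤ gradNormSq f x := sq_norm_pderiv_le_gradNormSq f x i

end Tame

end Broughton

/-- Broughton's theorem on tame polynomials.  Let `f : ℂⁿ → ℂ` be a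
tame polynomial map: for some `δ > 0` the set `{x : ‖grad f(x)‖ ≤ δ}` is compact (here
`‖grad f(x)‖` is the norm of the vector of partial derivatives of `f` at `x`).  Let `K`
be the set of critical values of `f`.  Then `f : ℂⁿ \ f⁻¹(K) → ℂ \ K` is a locally
trivial fibration; in other words, a tame polynomial has no critical values coming from
infinity. -/
theorem statement12 (n : ℕ) (hn : 1 ≤ n) (f : MvPolynomial (Fin n) ℂ)
    (htame : ∃ δ > (0:ℝ), IsCompact {x : Fin n → ℂ |
      ‖(fun i => MvPolynomial.eval x (MvPolynomial.pderiv i f) : Fin n → ℂ)‖ ≤ δ}) :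
    LocTrivFibration (fun x : {x : Fin n → ℂ // MvPolynomial.eval x f ∉ critValues n f} =>
      (⟨MvPolynomial.eval x.1 f, x.2⟩ : {t : ℂ // t ∉ critValues n f})) := by
  obtain ⟨δ, hδ, hc⟩ := htame
  refine locTrivFibration_of_flows (contDiff_real_eval f).continuous fun c hcK => ?_
  obtain ⟨r, hr, hrK⟩ := Metric.nhds_basis_closedBall.mem_iff.1
    ((isClosed_critValues_of_tame hδ hc).isOpen_compl.mem_nhds hcK)
  obtain ⟨ε, hε, hle⟩ := exists_le_gradNormSq_of_tame hδ hc Metric.isClosed_closedBall hrK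
  have hball : ∀ x, eval x f ∈ Metric.ball c r → ε ≤ gradNormSq f x :=
    fun x hx => hle x (Metric.ball_subset_closedBall hx)
  obtain ⟨Φ, hΦ⟩ := exists_flow_lifting_translation f hε (convex_ball c r) hball (e := 1) (by simp)
  obtain ⟨Ψ, hΨ⟩ := exists_flow_lifting_translation f hε (convex_ball c r) hball
    (e := Complex.I) (by simp)
  exact ⟨r, hr, Metric.ball_subset_closedBall.trans hrK, Φ, Ψ, hΦ, hΨ⟩

end
end
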